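/- Let T be a complete first-order theory such that, for all k ≥ 2, T does not have k-DCTP₂. Then for any small elementary submodel M of 𝕄 and any tuple b, there is a global type extending tp(b/M), finitely satisfiable in M, such that for any formula φ(x,y) with parameters in M: if coheir Morley sequences in this type do not witness Kim-dividing of φ(x,b) over M, then no coheir Morley sequence over M starting with b witnesses Kim-dividing of φ(x,b) over M. -/

import Mathlib

/- Common model-theoretic infrastructure for formalizing
   "NSOP₂ theories are NSOP₁" (arXiv:2206.08512).

   We work with a monster model `𝕄` of a complete theory: a sufficiently
   saturated and strongly homogeneous `L`-structure.  Tuples are functions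
   `α → 𝕄`; sets of formulas with parameters are coded via `FmlP`. -/

open FirstOrder Language

universe u v w

namespace NSOP2Paper

/-- A first-order formula in free variables `α ⊕ Fin n` together with an
`n`-tuple of parameters from `𝕄`. -/
abbrev FmlP (L : FirstOrder.Language.{u, u}) (𝕄 : Type u) (α : Type v) :=
  Σ n : ℕ, L.Formula (α ⊕ Fin n) × (Fin n → 𝕄)

/-- `a ≡_C b` : the tuples `a` and `b` satisfy the same formulas with
parameters from `C`. -/
def EqTpOver (L : FirstOrder.Language.{u, u}) {𝕄 : Type u} [L.Structure 𝕄] (C : Set 𝕄)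
    {α : Type v} (a b : α → 𝕄) : Prop :=
  ∀ (n : ℕ) (φ : L.Formula (α ⊕ Fin n)) (c : Fin n → 𝕄), (∀ i, c i ∈ C) →
    (φ.Realize (Sum.elim a c) ↔ φ.Realize (Sum.elim b c))

/-- `tp(a / C)` is finitely satisfiable in `Ms`: every formula over `C`
satisfied by `a` has a realization by a tuple from `Ms`. -/
def FinSatIn (L : FirstOrder.Language.{u, u}) {𝕄 : Type u} [L.Structure 𝕄] (Ms : Set 𝕄)
    {α : Type v} (a : α → 𝕄) (C : Set 𝕄) : Prop :=
  ∀ (n : ℕ) (φ : L.Formula (α ⊕ Fin n)) (c : Fin n → 𝕄), (∀ i, c i ∈ C) →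
    φ.Realize (Sum.elim a c) →
    ∃ m : α → 𝕄, (∀ i, m i ∈ Ms) ∧ φ.Realize (Sum.elim m c)

/-- `Ms` is the underlying set of a (small) elementary submodel of `𝕄`. -/
def IsElemSubmodel (L : FirstOrder.Language.{u, u}) {𝕄 : Type u} [L.Structure 𝕄] (Ms : Set 𝕄) : Prop :=
  ∃ S : L.ElementarySubstructure 𝕄, (S : Set 𝕄) = Ms

/-- A complete consistent global type (a complete type over the monster `𝕄`)
in variables `α`, coded as the set of formulas-with-parameters it contains. -/
structure GlobalType (L : FirstOrder.Language.{u, u}) (𝕄 : Type u) [L.Structure 𝕄] (α : Type v) where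
  carrier : Set (FmlP L 𝕄 α)
  consistent : ∀ t : Finset (FmlP L 𝕄 α), ↑t ⊆ carrier →
    ∃ a : α → 𝕄, ∀ p ∈ t, p.2.1.Realize (Sum.elim a p.2.2)
  complete : ∀ (n : ℕ) (φ : L.Formula (α ⊕ Fin n)) (c : Fin n → 𝕄),
    (⟨n, (φ, c)⟩ : FmlP L 𝕄 α) ∈ carrier ∨ (⟨n, (φ.not, c)⟩ : FmlP L 𝕄 α) ∈ carrier

variable {L : FirstOrder.Language.{u, u}} {𝕄 : Type u} [L.Structure 𝕄]

/-- The global type `q` is finitely satisfiable in `Ms` (i.e. it is a coheir of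
its restriction to `Ms`). -/
def GlobalType.FinSatInM {α : Type v} (q : GlobalType L 𝕄 α) (Ms : Set 𝕄) : Prop :=
  ∀ t : Finset (FmlP L 𝕄 α), ↑t ⊆ q.carrier →
    ∃ m : α → 𝕄, (∀ i, m i ∈ Ms) ∧ ∀ p ∈ t, p.2.1.Realize (Sum.elim m p.2.2)

/-- `a ⊨ q|_C` : the tuple `a` realizes the restriction of the global type `q`
to parameters from `C`. -/
def RealizesType {α : Type v} (q : GlobalType L 𝕄 α) (a : α → 𝕄) (C : Set 𝕄) : Prop :=
  ∀ (n : ℕ) (φ : L.Formula (α ⊕ Fin n)) (c : Fin n → 𝕄), (∀ i, c i ∈ C) →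
    (⟨n, (φ, c)⟩ : FmlP L 𝕄 α) ∈ q.carrier → φ.Realize (Sum.elim a c)

/-- The global type `q` extends `tp(a / C)`. -/
def ExtendsTpOver {α : Type v} (q : GlobalType L 𝕄 α) (C : Set 𝕄) (a : α → 𝕄) : Prop :=
  ∀ (n : ℕ) (φ : L.Formula (α ⊕ Fin n)) (c : Fin n → 𝕄), (∀ i, c i ∈ C) →
    φ.Realize (Sum.elim a c) → (⟨n, (φ, c)⟩ : FmlP L 𝕄 α) ∈ q.carrier

/-- `B` is a coheir Morley sequence over `Ms` in the global type `q`: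
`q` is finitely satisfiable in `Ms` and `B i ⊨ q|_(Ms ∪ B_{<i})`. -/
def MorleyIn {α : Type v} (q : GlobalType L 𝕄 α) (Ms : Set 𝕄) (B : ℕ → α → 𝕄) : Prop :=
  q.FinSatInM Ms ∧
    ∀ i : ℕ, RealizesType q (B i) (Ms ∪ ⋃ (j : ℕ) (_ : j < i), Set.range (B j))

/-- `B` is a coheir Morley sequence over `Ms`. -/
def CoheirMorley (L : FirstOrder.Language.{u, u}) {𝕄 : Type u} [L.Structure 𝕄] (Ms : Set 𝕄)
    {α : Type v} (B : ℕ → α → 𝕄) : Prop :=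
  ∃ q : GlobalType L 𝕄 α, MorleyIn q Ms B

/-- Flatten an `ℕ`-indexed sequence of `α`-tuples into a single tuple. -/
def flatSeq {α : Type v} (I : ℕ → α → 𝕄) : ℕ × α → 𝕄 := fun p => I p.1 p.2

/-- The sequence `I` is indiscernible over `C`. -/
def IndiscernibleOver (L : FirstOrder.Language.{u, u}) {𝕄 : Type u} [L.Structure 𝕄] (C : Set 𝕄)
    {α : Type v} (I : ℕ → α → 𝕄) : Prop :=
  ∀ (n : ℕ) (f g : Fin n → ℕ), StrictMono f → StrictMono g →
    EqTpOver L C (fun p : Fin n × α => I (f p.1) p.2) (fun p : Fin n × α => I (g p.1) p.2)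

/-- `𝕄` is `κ`-saturated: every finitely satisfiable set of formulas in fewer
than `κ` variables over a parameter set of size `< κ` is realized in `𝕄`. -/
def IsSaturated (L : FirstOrder.Language.{u, u}) (𝕄 : Type u) [L.Structure 𝕄] (κ : Cardinal.{u}) : Prop :=
  ∀ (α : Type u) (A : Set 𝕄), Cardinal.mk α < κ → Cardinal.mk A < κ →
    ∀ Γ : Set (FmlP L 𝕄 α), (∀ p ∈ Γ, ∀ i, p.2.2 i ∈ A) →
      (∀ t : Finset (FmlP L 𝕄 α), ↑t ⊆ Γ →
        ∃ a : α → 𝕄, ∀ p ∈ t, p.2.1.Realize (Sum.elim a p.2.2)) →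
      ∃ a : α → 𝕄, ∀ p ∈ Γ, p.2.1.Realize (Sum.elim a p.2.2)

/-- `𝕄` is strongly `κ`-homogeneous: partial elementary maps between tuples of
length `< κ` extend to automorphisms of `𝕄`. -/
def IsStronglyHomogeneous (L : FirstOrder.Language.{u, u}) (𝕄 : Type u) [L.Structure 𝕄]
    (κ : Cardinal.{u}) : Prop :=
  ∀ (α : Type u), Cardinal.mk α < κ → ∀ a b : α → 𝕄, EqTpOver L (∅ : Set 𝕄) a b →
    ∃ σ : 𝕄 ≃[L] 𝕄, ∀ i, σ (a i) = b i

/-- `𝕄` is a monster model (for smallness degree `κ`): sufficiently saturated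
and strongly homogeneous. -/
def IsMonster (L : FirstOrder.Language.{u, u}) (𝕄 : Type u) [L.Structure 𝕄] (κ : Cardinal.{u}) : Prop :=
  Cardinal.aleph0 < κ ∧ IsSaturated L 𝕄 κ ∧ IsStronglyHomogeneous L 𝕄 κ

/-! ### Tree combinatorics -/

/-- The meet (longest common prefix) of two finite sequences. -/
def meet {A : Type w} [DecidableEq A] : List A → List A → List A
  | a :: as, b :: bs => if a = b then a :: meet as bs else []
  | _, _ => []

/-- The meet of `η 0, …, η i`. -/
def combMeet {A : Type w} [DecidableEq A] {k : ℕ} (η : Fin k → List A) (i : Fin k) : List A :=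
  (List.ofFn fun j : Fin i.val => η (Fin.castLE i.2.le j)).foldl meet (η i)

/-- `η 0, …, η (k-1)` is a descending comb: a lexicographically increasing
antichain such that the meet of `η 0, …, η (i+1)` is a proper initial segment
of the meet of `η 0, …, η i`. -/
def DescendingComb {A : Type w} [DecidableEq A] [LT A] {k : ℕ} (η : Fin k → List A) : Prop :=
  (∀ i j : Fin k, i ≠ j → ¬ η i <+: η j) ∧
  (∀ i j : Fin k, i < j → List.Lex (· < ·) (η i) (η j)) ∧
  (∀ (i : ℕ) (h : i + 1 < k),
    combMeet η ⟨i + 1, h⟩ <+: combMeet η ⟨i, by omega⟩ ∧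
    combMeet η ⟨i + 1, h⟩ ≠ combMeet η ⟨i, by omega⟩)

/-! ### Tree properties of theories (witnessed in the monster model) -/

/-- `T = Th(𝕄)` has `SOP₁`. -/
def HasSOP1 (L : FirstOrder.Language.{u, u}) (𝕄 : Type u) [L.Structure 𝕄] : Prop :=
  ∃ (k m : ℕ) (φ : L.Formula (Fin k ⊕ Fin m)) (b : List Bool → Fin m → 𝕄),
    (∀ σ : ℕ → Bool, ∃ a : Fin k → 𝕄,
      ∀ n : ℕ, φ.Realize (Sum.elim a (b (List.ofFn fun i : Fin n => σ i)))) ∧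
    ∀ η₁ η₂ : List Bool, (η₁ ++ [false]) <+: η₂ →
      ¬ ∃ a : Fin k → 𝕄, φ.Realize (Sum.elim a (b η₂)) ∧
        φ.Realize (Sum.elim a (b (η₁ ++ [true])))

/-- `T = Th(𝕄)` has `SOP₂`. -/
def HasSOP2 (L : FirstOrder.Language.{u, u}) (𝕄 : Type u) [L.Structure 𝕄] : Prop :=
  ∃ (k m : ℕ) (φ : L.Formula (Fin k ⊕ Fin m)) (b : List Bool → Fin m → 𝕄),
    (∀ σ : ℕ → Bool, ∃ a : Fin k → 𝕄,
      ∀ n : ℕ, φ.Realize (Sum.elim a (b (List.ofFn fun i : Fin n => σ i)))) ∧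
    ∀ η₁ η₂ : List Bool, ¬ η₁ <+: η₂ → ¬ η₂ <+: η₁ →
      ¬ ∃ a : Fin k → 𝕄, φ.Realize (Sum.elim a (b η₁)) ∧ φ.Realize (Sum.elim a (b η₂))

/-- `T = Th(𝕄)` has `k`-`DCTP₁`: paths are consistent but descending combs of
size `k` are inconsistent. -/
def HasKDCTP1 (L : FirstOrder.Language.{u, u}) (𝕄 : Type u) [L.Structure 𝕄] (k : ℕ) : Prop :=
  ∃ (r m : ℕ) (φ : L.Formula (Fin r ⊕ Fin m)) (b : List ℕ → Fin m → 𝕄),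
    (∀ σ : ℕ → ℕ, ∃ a : Fin r → 𝕄,
      ∀ n : ℕ, φ.Realize (Sum.elim a (b (List.ofFn fun i : Fin n => σ i)))) ∧
    ∀ η : Fin k → List ℕ, DescendingComb η →
      ¬ ∃ a : Fin r → 𝕄, ∀ i, φ.Realize (Sum.elim a (b (η i)))

/-- `T = Th(𝕄)` has weak `k`-`TP₁`: paths are consistent but any `k` pairwise
incomparable nodes with common pairwise meet are inconsistent. -/
def HasWeakKTP1 (L : FirstOrder.Language.{u, u}) (𝕄 : Type u) [L.Structure 𝕄] (k : ℕ) : Prop :=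
  ∃ (r m : ℕ) (φ : L.Formula (Fin r ⊕ Fin m)) (b : List ℕ → Fin m → 𝕄),
    (∀ σ : ℕ → ℕ, ∃ a : Fin r → 𝕄,
      ∀ n : ℕ, φ.Realize (Sum.elim a (b (List.ofFn fun i : Fin n => σ i)))) ∧
    ∀ η : Fin k → List ℕ,
      (∀ i j, i ≠ j → ¬ η i <+: η j) →
      (∀ i j i' j' : Fin k, i ≠ j → i' ≠ j' → meet (η i) (η j) = meet (η i') (η j')) →
      ¬ ∃ a : Fin r → 𝕄, ∀ i, φ.Realize (Sum.elim a (b (η i)))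

/-- `T = Th(𝕄)` has `k`-`DCTP₂`: paths are `k`-inconsistent but descending
combs are consistent. -/
def HasKDCTP2 (L : FirstOrder.Language.{u, u}) (𝕄 : Type u) [L.Structure 𝕄] (k : ℕ) : Prop :=
  ∃ (r m : ℕ) (φ : L.Formula (Fin r ⊕ Fin m)) (b : List Bool → Fin m → 𝕄),
    (∀ σ : ℕ → Bool, ∀ s : Finset ℕ, s.card = k →
      ¬ ∃ a : Fin r → 𝕄, ∀ n ∈ s,
        φ.Realize (Sum.elim a (b (List.ofFn fun i : Fin n => σ i)))) ∧
    ∀ (l : ℕ) (η : Fin l → List Bool), DescendingComb η →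
      ∃ a : Fin r → 𝕄, ∀ i, φ.Realize (Sum.elim a (b (η i)))

/-! ### Kim-dividing and Conant-dividing, with respect to coheir Morley sequences -/

/-- `φ(x, b)` Kim-divides over `Ms`: some coheir Morley sequence over `Ms`
starting with `b` makes it inconsistent. -/
def KimDivides (L : FirstOrder.Language.{u, u}) {𝕄 : Type u} [L.Structure 𝕄] (Ms : Set 𝕄)
    {α : Type v} {n : ℕ} (φ : L.Formula (α ⊕ Fin n)) (b : Fin n → 𝕄) : Prop :=
  ∃ B : ℕ → Fin n → 𝕄, CoheirMorley L Ms B ∧ B 0 = b ∧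
    ¬ ∃ a : α → 𝕄, ∀ i, φ.Realize (Sum.elim a (B i))

/-- `φ(x, b)` Kim-forks over `Ms`: it implies a finite disjunction of formulas
Kim-dividing over `Ms`. -/
def KimForks (L : FirstOrder.Language.{u, u}) {𝕄 : Type u} [L.Structure 𝕄] (Ms : Set 𝕄)
    {α : Type v} {n : ℕ} (φ : L.Formula (α ⊕ Fin n)) (b : Fin n → 𝕄) : Prop :=
  ∃ (N : ℕ) (m : Fin N → ℕ) (ψ : ∀ j : Fin N, L.Formula (α ⊕ Fin (m j)))
    (c : ∀ j : Fin N, Fin (m j) → 𝕄),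
    (∀ j, KimDivides L Ms (ψ j) (c j)) ∧
    ∀ a : α → 𝕄, φ.Realize (Sum.elim a b) → ∃ j, (ψ j).Realize (Sum.elim a (c j))

/-- `φ(x, b)` Conant-divides over `Ms`: every coheir Morley sequence over `Ms`
starting with `b` makes it inconsistent. -/
def ConantDivides (L : FirstOrder.Language.{u, u}) {𝕄 : Type u} [L.Structure 𝕄] (Ms : Set 𝕄)
    {α : Type v} {n : ℕ} (φ : L.Formula (α ⊕ Fin n)) (b : Fin n → 𝕄) : Prop :=
  ∀ B : ℕ → Fin n → 𝕄, CoheirMorley L Ms B → B 0 = b →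
    ¬ ∃ a : α → 𝕄, ∀ i, φ.Realize (Sum.elim a (B i))

/-- `φ(x, b)` Conant-forks over `Ms`. -/
def ConantForks (L : FirstOrder.Language.{u, u}) {𝕄 : Type u} [L.Structure 𝕄] (Ms : Set 𝕄)
    {α : Type v} {n : ℕ} (φ : L.Formula (α ⊕ Fin n)) (b : Fin n → 𝕄) : Prop :=
  ∃ (N : ℕ) (m : Fin N → ℕ) (ψ : ∀ j : Fin N, L.Formula (α ⊕ Fin (m j)))
    (c : ∀ j : Fin N, Fin (m j) → 𝕄),
    (∀ j, ConantDivides L Ms (ψ j) (c j)) ∧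
    ∀ a : α → 𝕄, φ.Realize (Sum.elim a b) → ∃ j, (ψ j).Realize (Sum.elim a (c j))

/-- `a ⫝^{K*}_{Ms} b` : `tp(a/Ms b)` contains no formula Conant-forking
over `Ms`. -/
def ConantIndep (L : FirstOrder.Language.{u, u}) {𝕄 : Type u} [L.Structure 𝕄] (Ms : Set 𝕄)
    {α : Type v} {β : Type w} (a : α → 𝕄) (b : β → 𝕄) : Prop :=
  ∀ (n : ℕ) (φ : L.Formula (α ⊕ Fin n)) (d : Fin n → 𝕄),
    (∀ i, d i ∈ Ms ∪ Set.range b) → φ.Realize (Sum.elim a d) →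
    ¬ ConantForks L Ms φ d

/-! ### Abstract independence relations between sets over models -/

/-- An abstract ternary relation `A ⫝_M B` between subsets of `𝕄` over
(elementary submodels of) `𝕄`. -/
structure IndRel (L : FirstOrder.Language.{u, u}) (𝕄 : Type u) [L.Structure 𝕄] where
  rel : Set 𝕄 → Set 𝕄 → Set 𝕄 → Prop

/-- A set `S` of `α`-tuples is type-definable over `C`. -/
def TypeDefinableOver (L : FirstOrder.Language.{u, u}) {𝕄 : Type u} [L.Structure 𝕄] (C : Set 𝕄)
    {γ : Type v} (S : Set (γ → 𝕄)) : Prop :=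
  ∃ Γ : Set (FmlP L 𝕄 γ), (∀ p ∈ Γ, ∀ i, p.2.2 i ∈ C) ∧
    ∀ g : γ → 𝕄, g ∈ S ↔ ∀ p ∈ Γ, p.2.1.Realize (Sum.elim g p.2.2)

namespace IndRel

/-- Invariance under automorphisms of `𝕄`. -/
def Invariant (R : IndRel L 𝕄) : Prop :=
  ∀ (σ : 𝕄 ≃[L] 𝕄) (A Ms B : Set 𝕄), R.rel A Ms B →
    R.rel ((⇑σ) '' A) ((⇑σ) '' Ms) ((⇑σ) '' B)

/-- Monotonicity (on both sides). -/
def Mono (R : IndRel L 𝕄) : Prop :=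
  ∀ (A A' Ms B B' : Set 𝕄), IsElemSubmodel L Ms → R.rel A Ms B →
    Ms ⊆ A' → A' ⊆ A → Ms ⊆ B' → B' ⊆ B → R.rel A' Ms B'

/-- Existence: for `M ⊆ A, B` there is `A' ≡_M A` with `A' ⫝_M B`. -/
def Existence (R : IndRel L 𝕄) (κ : Cardinal.{u}) : Prop :=
  ∀ (Ms : Set 𝕄), IsElemSubmodel L Ms → Cardinal.mk Ms < κ →
    ∀ (α β : Type u), Cardinal.mk α < κ → Cardinal.mk β < κ →
      ∀ (a : α → 𝕄) (b : β → 𝕄),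
        ∃ a' : α → 𝕄, EqTpOver L Ms a' a ∧
          R.rel (Ms ∪ Set.range a') Ms (Ms ∪ Set.range b)

/-- Right extension. -/
def RightExt (R : IndRel L 𝕄) (κ : Cardinal.{u}) : Prop :=
  ∀ (Ms : Set 𝕄), IsElemSubmodel L Ms → Cardinal.mk Ms < κ →
    ∀ (α : Type u), Cardinal.mk α < κ → ∀ (a : α → 𝕄) (B C : Set 𝕄),
      Cardinal.mk B < κ → Cardinal.mk C < κ →
      R.rel (Set.range a) Ms B → B ⊆ C →
      ∃ a' : α → 𝕄, EqTpOver L B a' a ∧ R.rel (Set.range a') Ms C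

/-- Quasi-strong finite character: for complete types `p = tp(a₀/Ms)` and
`q = tp(b₀/Ms)`, the set of pairs of realizations `(a, b)` with `a ⫝_Ms b`
is type-definable over `Ms`. -/
def QSFC (R : IndRel L 𝕄) (κ : Cardinal.{u}) : Prop :=
  ∀ (Ms : Set 𝕄), IsElemSubmodel L Ms → Cardinal.mk Ms < κ →
    ∀ (α β : Type u), Cardinal.mk α < κ → Cardinal.mk β < κ →
      ∀ (a₀ : α → 𝕄) (b₀ : β → 𝕄),
        TypeDefinableOver L Ms {g : (α ⊕ β) → 𝕄 |
          EqTpOver L Ms (g ∘ Sum.inl) a₀ ∧ EqTpOver L Ms (g ∘ Sum.inr) b₀ ∧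
          R.rel (Set.range (g ∘ Sum.inl)) Ms (Set.range (g ∘ Sum.inr))}

/-- The coheir chain condition. -/
def CoheirChain (R : IndRel L 𝕄) (κ : Cardinal.{u}) : Prop :=
  ∀ (Ms : Set 𝕄), IsElemSubmodel L Ms → Cardinal.mk Ms < κ →
    ∀ (α β : Type u), Cardinal.mk α < κ → Cardinal.mk β < κ →
      ∀ (a : α → 𝕄) (b : β → 𝕄), R.rel (Set.range a) Ms (Set.range b) →
        ∀ I : ℕ → β → 𝕄, CoheirMorley L Ms I → I 0 = b →
          ∃ I' : ℕ → β → 𝕄, EqTpOver L Ms (flatSeq I') (flatSeq I) ∧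
            R.rel (Set.range a) Ms (⋃ i, Set.range (I' i)) ∧
            ∀ i, EqTpOver L (Ms ∪ Set.range a) (I' i) b

/-- `R` implies `⫝ʰ` : `A ⫝_M B` implies `tp(B / M A)` is finitely
satisfiable in `M`. -/
def StrongerThanH (R : IndRel L 𝕄) : Prop :=
  ∀ (A Ms B : Set 𝕄), IsElemSubmodel L Ms → R.rel A Ms B →
    FinSatIn L Ms (fun x : B => (x : 𝕄)) (Ms ∪ A)

end IndRel

/-- The axioms satisfied by the relations among which `⫝^CK` is weakest. -/
def GoodRel (R : IndRel L 𝕄) (κ : Cardinal.{u}) : Prop :=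
  R.StrongerThanH ∧ R.Invariant ∧ R.Mono ∧ R.Existence κ ∧ R.RightExt κ ∧ R.CoheirChain κ

/-- `R` is `⫝^CK` : the weakest relation implying `⫝ʰ` and satisfying
invariance, monotonicity, existence, right extension and the coheir chain
condition. -/
def IsCK (R : IndRel L 𝕄) (κ : Cardinal.{u}) : Prop :=
  GoodRel R κ ∧ ∀ R' : IndRel L 𝕄, GoodRel R' κ →
    ∀ A Ms B : Set 𝕄, R'.rel A Ms B → R.rel A Ms B

/-- `q` is a canonical global type over `Ms` (w.r.t. the relation `R = ⫝^CK`):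
whenever `c ⊨ q|_{Ms b}` we have `b ⫝^CK_{Ms} c`. -/
def IsCanonicalGlobal (R : IndRel L 𝕄) (κ : Cardinal.{u}) (Ms : Set 𝕄) {α : Type v}
    (q : GlobalType L 𝕄 α) : Prop :=
  ∀ (β : Type u), Cardinal.mk β < κ → ∀ (b : β → 𝕄) (c : α → 𝕄),
    RealizesType q c (Ms ∪ Set.range b) → R.rel (Set.range b) Ms (Set.range c)

/-- A canonical Morley sequence over `Ms`: a coheir Morley sequence in a
canonical coheir. -/
def CanonicalMorley (R : IndRel L 𝕄) (κ : Cardinal.{u}) (Ms : Set 𝕄) {α : Type v}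
    (I : ℕ → α → 𝕄) : Prop :=
  ∃ q : GlobalType L 𝕄 α, IsCanonicalGlobal R κ Ms q ∧ MorleyIn q Ms I

/-- `q` is a strong canonical global type over `Ms`. -/
def IsStrongCanonical (R : IndRel L 𝕄) (κ : Cardinal.{u}) (Ms : Set 𝕄) {α : Type v}
    (q : GlobalType L 𝕄 α) : Prop :=
  ∀ (β : Type u), Cardinal.mk β < κ → ∀ (b : β → 𝕄) (c : α → 𝕄),
    RealizesType q c (Ms ∪ Set.range b) →
    ∀ (γ : Type u), Cardinal.mk γ < κ → ∀ (a : γ → 𝕄),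
      ∃ a' : γ → 𝕄, EqTpOver L (Ms ∪ Set.range c) a' a ∧
        ∃ q' : GlobalType L 𝕄 (γ ⊕ α), IsCanonicalGlobal R κ Ms q' ∧
          ExtendsTpOver q' (Ms ∪ Set.range b) (Sum.elim a' c)

/-! ### `M`-invariant ideals and `𝓘`-Kim-dividing -/

/-- An `Ms`-invariant ideal on the definable subsets of `𝕄` (in variables `α`). -/
structure InvIdeal (L : FirstOrder.Language.{u, u}) (𝕄 : Type u) [L.Structure 𝕄] (Ms : Set 𝕄)
    (α : Type v) where
  mem : Set (α → 𝕄) → Prop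
  definable_of_mem : ∀ S, mem S → ∃ (n : ℕ) (ψ : L.Formula (α ⊕ Fin n)) (c : Fin n → 𝕄),
    S = {a : α → 𝕄 | ψ.Realize (Sum.elim a c)}
  union_mem : ∀ S T, mem S → mem T → mem (S ∪ T)
  subset_mem : ∀ S T, mem S →
    (∃ (n : ℕ) (ψ : L.Formula (α ⊕ Fin n)) (c : Fin n → 𝕄),
      T = {a : α → 𝕄 | ψ.Realize (Sum.elim a c)}) →
    T ⊆ S → mem T
  invariant : ∀ σ : 𝕄 ≃[L] 𝕄, (∀ x ∈ Ms, σ x = x) → ∀ S, mem S →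
    mem ((fun a => (⇑σ) ∘ a) '' S)

/-- `φ(x, b)` `𝓘`-Kim-divides over `Ms`. -/
def IKimDivides {Ms : Set 𝕄} {α : Type v} (I : InvIdeal L 𝕄 Ms α) {n : ℕ}
    (φ : L.Formula (α ⊕ Fin n)) (b : Fin n → 𝕄) : Prop :=
  ∃ (B : ℕ → Fin n → 𝕄) (k : ℕ), CoheirMorley L Ms B ∧ B 0 = b ∧ 0 < k ∧
    ∀ s : Finset ℕ, s.card = k →
      I.mem {a : α → 𝕄 | ∀ i ∈ s, φ.Realize (Sum.elim a (B i))}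

/-- `φ(x, b)` `𝓘`-Kim-forks over `Ms`. -/
def IKimForks {Ms : Set 𝕄} {α : Type v} (I : InvIdeal L 𝕄 Ms α) {n : ℕ}
    (φ : L.Formula (α ⊕ Fin n)) (b : Fin n → 𝕄) : Prop :=
  ∃ (N : ℕ) (m : Fin N → ℕ) (ψ : ∀ j : Fin N, L.Formula (α ⊕ Fin (m j)))
    (c : ∀ j : Fin N, Fin (m j) → 𝕄),
    (∀ j, IKimDivides I (ψ j) (c j)) ∧
    ∀ a : α → 𝕄, φ.Realize (Sum.elim a b) → ∃ j, (ψ j).Realize (Sum.elim a (c j))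

/-- `φ(x, b)` `𝓘`-quasi-divides over `Ms`. -/
def IQuasiDivides {Ms : Set 𝕄} {α : Type v} (I : InvIdeal L 𝕄 Ms α) {n : ℕ}
    (φ : L.Formula (α ⊕ Fin n)) (b : Fin n → 𝕄) : Prop :=
  ∃ (mm : ℕ) (b' : Fin mm → Fin n → 𝕄), 0 < mm ∧ (∀ j, EqTpOver L Ms (b' j) b) ∧
    I.mem {a : α → 𝕄 | ∀ j, φ.Realize (Sum.elim a (b' j))}

/-! ### `h^⫝`-inconsistency and the derived relation `⫝'` -/

/-- A family of formulas is `h^⫝`-inconsistent with respect to `P = tp(a₀/Ms)`. -/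
def HInconsistent (R : IndRel L 𝕄) (Ms : Set 𝕄) {α : Type v} (a₀ : α → 𝕄)
    {ι : Type w} (m : ι → ℕ) (φ : ∀ i : ι, L.Formula (α ⊕ Fin (m i)))
    (b : ∀ i : ι, Fin (m i) → 𝕄) : Prop :=
  ¬ ∃ a : α → 𝕄, EqTpOver L Ms a a₀ ∧
      R.rel (Set.range a) Ms (⋃ i, Set.range (b i)) ∧
      ∀ i, (φ i).Realize (Sum.elim a (b i))

/-- A single formula is `h^⫝`-inconsistent with respect to `P = tp(a₀/Ms)`. -/
def HInconsistentSingle (R : IndRel L 𝕄) (Ms : Set 𝕄) {α : Type v} (a₀ : α → 𝕄)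
    {n : ℕ} (φ : L.Formula (α ⊕ Fin n)) (b : Fin n → 𝕄) : Prop :=
  ¬ ∃ a : α → 𝕄, EqTpOver L Ms a a₀ ∧ R.rel (Set.range a) Ms (Set.range b) ∧
      φ.Realize (Sum.elim a b)

/-- `φ(x, b)` `h^⫝`-Kim-divides with respect to `tp(a₀/Ms)`. -/
def HKimDivides (R : IndRel L 𝕄) (Ms : Set 𝕄) {α : Type v} (a₀ : α → 𝕄)
    {n : ℕ} (φ : L.Formula (α ⊕ Fin n)) (b : Fin n → 𝕄) : Prop :=
  ∃ B : ℕ → Fin n → 𝕄, CoheirMorley L Ms B ∧ B 0 = b ∧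
    HInconsistent R Ms a₀ (fun _ : ℕ => n) (fun _ => φ) B

/-- `φ(x, b)` `h^⫝`-Kim-forks with respect to `tp(a₀/Ms)`. -/
def HKimForks (R : IndRel L 𝕄) (Ms : Set 𝕄) {α : Type v} (a₀ : α → 𝕄)
    {n : ℕ} (φ : L.Formula (α ⊕ Fin n)) (b : Fin n → 𝕄) : Prop :=
  ∃ (N : ℕ) (m : Fin N → ℕ) (ψ : ∀ j : Fin N, L.Formula (α ⊕ Fin (m j)))
    (c : ∀ j : Fin N, Fin (m j) → 𝕄),
    (∀ j, HKimDivides R Ms a₀ (ψ j) (c j)) ∧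
    ∀ a : α → 𝕄, φ.Realize (Sum.elim a b) → ∃ j, (ψ j).Realize (Sum.elim a (c j))

/-- `φ(x, b)` `h^⫝`-quasi-divides with respect to `tp(a₀/Ms)`. -/
def HQuasiDivides (R : IndRel L 𝕄) (Ms : Set 𝕄) {α : Type v} (a₀ : α → 𝕄)
    {n : ℕ} (φ : L.Formula (α ⊕ Fin n)) (b : Fin n → 𝕄) : Prop :=
  ∃ (mm : ℕ) (b' : Fin mm → Fin n → 𝕄), 0 < mm ∧ (∀ j, EqTpOver L Ms (b' j) b) ∧
    HInconsistent R Ms a₀ (fun _ : Fin mm => n) (fun _ => φ) b'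

/-- The derived relation `⫝'` on tuples:
`tp(a / Ms b)` contains no formula `h^⫝`-Kim-forking w.r.t. `tp(a/Ms)`. -/
def DerivedIndep (R : IndRel L 𝕄) (Ms : Set 𝕄) {α : Type v} {β : Type w}
    (a : α → 𝕄) (b : β → 𝕄) : Prop :=
  ∀ (n : ℕ) (φ : L.Formula (α ⊕ Fin n)) (d : Fin n → 𝕄),
    (∀ i, d i ∈ Ms ∪ Set.range b) → φ.Realize (Sum.elim a d) →
    ¬ HKimForks R Ms a φ d

/-- The derived relation `⫝'` as a relation between sets over models. -/
def derived (R : IndRel L 𝕄) : IndRel L 𝕄 where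
  rel A Ms B := ∀ (n : ℕ) (φ : L.Formula (↥A ⊕ Fin n)) (d : Fin n → 𝕄),
    (∀ i, d i ∈ Ms ∪ B) → φ.Realize (Sum.elim (fun x : A => (x : 𝕄)) d) →
    ¬ HKimForks R Ms (fun x : A => (x : 𝕄)) φ d

/-! ### Coheir trees -/

/-- The tuple, indexed by extensions, consisting of the part of the tree `c`
lying (weakly) above the node `ν` (where `ν` has length `Lh`). -/
def subtreeTupleLen {α : Type v} {n : ℕ} (c : {l : List ℕ // l.length ≤ n} → α → 𝕄)
    (Lh : ℕ) (ν : List ℕ) (hν : ν.length = Lh) :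
    ({s : List ℕ // Lh + s.length ≤ n} × α) → 𝕄 :=
  fun p => c ⟨ν ++ p.1.1, by rw [List.length_append, hν]; exact p.1.2⟩ p.2

end NSOP2Paper

namespace NSOP2Paper

section Ultrafilters

open Filter

/-- A definability structure on a set `X`: a family of "definable" sets of finite tuples from `X`,
closed under Boolean operations, reindexing of variables, projections and fixing coordinates. -/
structure DefStr (X : Type u) where
  IsDef : ∀ {F : Type}, Set (F → X) → Prop
  univ : ∀ F : Type, IsDef (Set.univ : Set (F → X))
  compl : ∀ {F : Type} {D : Set (F → X)}, IsDef D → IsDef Dᶜ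
  inter : ∀ {F : Type} {D E : Set (F → X)}, IsDef D → IsDef E → IsDef (D ∩ E)
  reindex : ∀ {F G : Type} (f : F → G) {D : Set (F → X)}, IsDef D →
    IsDef ((fun y : G → X => y ∘ f) ⁻¹' D)
  proj : ∀ {F G : Type} [Finite F] [Finite G] (f : F → G) {D : Set (G → X)}, IsDef D →
    IsDef ((fun y : G → X => y ∘ f) '' D)
  slice : ∀ {F G : Type} {D : Set (F ⊕ G → X)} (c : G → X), IsDef D →
    IsDef ((fun x : F → X => Sum.elim x c) ⁻¹' D)

/-- The marginal of an ultrafilter on tuples along a map of index sets. -/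
def restrict {X : Type u} {F G : Type} (f : F → G) (W : Ultrafilter (G → X)) :
    Ultrafilter (F → X) :=
  W.map fun y => y ∘ f

/-- The type of a pair `(a, b)` with `b` realizing the coheir given by `V` over `a ⊨ U`. -/
def tens {X : Type u} {F G : Type} (U : Ultrafilter (F → X)) (V : Ultrafilter (G → X)) :
    Ultrafilter (F ⊕ G → X) :=
  V.bind fun v => U.map fun x => Sum.elim x v

section Marginals

variable {X : Type u} {F G H K : Type}

theorem mem_restrict {f : F → G} {W : Ultrafilter (G → X)} {S : Set (F → X)} :
    S ∈ restrict f W ↔ (fun y : G → X => y ∘ f) ⁻¹' S ∈ W :=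
  Iff.rfl

theorem restrict_restrict (f : F → G) (g : G → H) (W : Ultrafilter (H → X)) :
    restrict f (restrict g W) = restrict (g ∘ f) W :=
  rfl

theorem restrict_id (W : Ultrafilter (F → X)) : restrict id W = W :=
  rfl

theorem restrict_congr {f g : F → G} (h : ∀ x, f x = g x) (W : Ultrafilter (G → X)) :
    restrict f W = restrict g W := by
  rw [funext h]

theorem mem_tens {U : Ultrafilter (F → X)} {V : Ultrafilter (G → X)} {S : Set (F ⊕ G → X)} :
    S ∈ tens U V ↔ ∀ᶠ v in (V : Filter (G → X)), ∀ᶠ x in (U : Filter (F → X)), Sum.elim x v ∈ S :=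
  Iff.rfl

theorem restrict_map_tens (f : F → G) (g : H → K) (U : Ultrafilter (G → X))
    (V : Ultrafilter (K → X)) :
    restrict (Sum.map f g) (tens U V) = tens (restrict f U) (restrict g V) := by
  ext S
  simp only [mem_restrict, mem_tens, Set.mem_preimage, Sum.elim_comp_map]
  rfl

theorem restrict_inl_tens (U : Ultrafilter (F → X)) (V : Ultrafilter (G → X)) :
    restrict Sum.inl (tens U V) = U := by
  ext S
  simp only [mem_restrict, mem_tens, Set.mem_preimage, Sum.elim_comp_inl]
  simp

theorem restrict_inr_tens (U : Ultrafilter (F → X)) (V : Ultrafilter (G → X)) :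
    restrict Sum.inr (tens U V) = V := by
  ext S
  simp only [mem_restrict, mem_tens, Set.mem_preimage, Sum.elim_comp_inr]
  simp

theorem continuous_restrict (f : F → G) :
    Continuous (restrict f : Ultrafilter (G → X) → Ultrafilter (F → X)) := by
  refine ultrafilterBasis_is_basis.continuous_iff.2 ?_
  rintro _ ⟨S, rfl⟩
  exact ultrafilter_isOpen_basic _

end Marginals

namespace DefStr

variable {X : Type u} (𝔇 : DefStr X) {F G : Type}

/-- Two ultrafilters induce the same type: they contain the same definable sets. -/
def SameType (U V : Ultrafilter (F → X)) : Prop :=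
  ∀ D, 𝔇.IsDef D → (D ∈ U ↔ D ∈ V)

/-- The filter of a type, generated by the definable sets of an ultrafilter. -/
def typeFilter (U : Ultrafilter (F → X)) : Filter (F → X) where
  sets := {S | ∃ D, 𝔇.IsDef D ∧ D ∈ U ∧ D ⊆ S}
  univ_sets := ⟨_, 𝔇.univ F, univ_mem, subset_rfl⟩
  sets_of_superset := fun ⟨D, h, hU, hS⟩ hST => ⟨D, h, hU, hS.trans hST⟩
  inter_sets := fun ⟨D, h, hU, hS⟩ ⟨E, h', hU', hS'⟩ =>
    ⟨D ∩ E, 𝔇.inter h h', inter_mem hU hU', Set.inter_subset_inter hS hS'⟩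

variable {𝔇}

theorem mem_typeFilter {U : Ultrafilter (F → X)} {S : Set (F → X)} :
    S ∈ 𝔇.typeFilter U ↔ ∃ D, 𝔇.IsDef D ∧ D ∈ U ∧ D ⊆ S :=
  Iff.rfl

theorem SameType.refl (U : Ultrafilter (F → X)) : 𝔇.SameType U U := fun _ _ => Iff.rfl

theorem SameType.symm {U V : Ultrafilter (F → X)} (h : 𝔇.SameType U V) : 𝔇.SameType V U :=
  fun D hD => (h D hD).symm

theorem SameType.trans {U V W : Ultrafilter (F → X)} (h : 𝔇.SameType U V)
    (h' : 𝔇.SameType V W) : 𝔇.SameType U W :=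
  fun D hD => (h D hD).trans (h' D hD)

theorem sameType_of_imp {U V : Ultrafilter (F → X)} (h : ∀ D, 𝔇.IsDef D → D ∈ U → D ∈ V) :
    𝔇.SameType U V := fun D hD =>
  ⟨h D hD, fun hV => by
    by_contra hU
    exact Ultrafilter.compl_mem_iff_notMem.1
      (h _ (𝔇.compl hD) (Ultrafilter.compl_mem_iff_notMem.2 hU)) hV⟩

theorem sameType_of_le {U V : Ultrafilter (F → X)}
    (h : (V : Filter (F → X)) ≤ 𝔇.typeFilter U) : 𝔇.SameType V U :=
  (sameType_of_imp fun D hD hU => h (mem_typeFilter.2 ⟨D, hD, hU, subset_rfl⟩)).symm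

theorem SameType.restrict {U V : Ultrafilter (G → X)} (h : 𝔇.SameType U V) (f : F → G) :
    𝔇.SameType (restrict f U) (restrict f V) :=
  fun _ hD => h _ (𝔇.reindex f hD)

theorem SameType.tens_left {U U' : Ultrafilter (F → X)} (h : 𝔇.SameType U U')
    (V : Ultrafilter (G → X)) : 𝔇.SameType (tens U V) (tens U' V) := fun _ hD => by
  simp only [mem_tens]
  exact eventually_congr (Eventually.of_forall fun v => h _ (𝔇.slice v hD))

/-- Left extension for coheirs: a coheir of the restriction of a type to some of the variables
extends to a coheir of the whole type. -/
theorem exists_extension [Finite F] [Finite G] (f : F → G) (V : Ultrafilter (F → X))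
    (U : Ultrafilter (G → X)) (h : 𝔇.SameType V (NSOP2Paper.restrict f U)) :
    ∃ W : Ultrafilter (G → X), 𝔇.SameType W U ∧ NSOP2Paper.restrict f W = V := by
  have : NeBot (comap (fun y : G → X => y ∘ f) V ⊓ 𝔇.typeFilter U) := by
    rw [inf_neBot_iff]
    rintro S ⟨A, hA, hAS⟩ T ⟨D, hD, hDU, hDT⟩
    have hproj : (fun y : G → X => y ∘ f) '' D ∈ V :=
      (h _ (𝔇.proj f hD)).2 (mem_restrict.2 (mem_of_superset hDU (Set.subset_preimage_image _ _)))
    obtain ⟨_, hxA, y, hyD, rfl⟩ := V.nonempty_of_mem (inter_mem hA hproj)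
    exact ⟨y, hAS hxA, hDT hyD⟩
  obtain ⟨W, hW⟩ := Ultrafilter.exists_le (comap (fun y : G → X => y ∘ f) V ⊓ 𝔇.typeFilter U)
  refine ⟨W, sameType_of_le (hW.trans inf_le_right), Ultrafilter.eq_of_le ?_⟩
  exact map_le_iff_le_comap.2 (hW.trans inf_le_left)

/-- Types of finitely many configurations sharing a common part of the same type amalgamate. -/
theorem exists_amalgam {ι α : Type} [Finite ι] [Finite α] {H : ι → Type} [∀ j, Finite (H j)]
    (U : Ultrafilter (α → X)) (W : ∀ j, Ultrafilter (H j ⊕ α → X))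
    (h : ∀ j, 𝔇.SameType (NSOP2Paper.restrict Sum.inr (W j)) U) :
    ∃ W' : Ultrafilter ((Σ j, H j) ⊕ α → X), 𝔇.SameType (NSOP2Paper.restrict Sum.inr W') U ∧
      ∀ j, 𝔇.SameType (NSOP2Paper.restrict (Sum.map (Sigma.mk j) id) W') (W j) := by
  let r : ∀ j, ((Σ j, H j) ⊕ α → X) → (H j ⊕ α → X) := fun j y => y ∘ Sum.map (Sigma.mk j) id
  have : NeBot ((⨅ j, comap (r j) (𝔇.typeFilter (W j))) ⊓
      comap (fun y => y ∘ Sum.inr) (𝔇.typeFilter U)) := by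
    rw [inf_neBot_iff]
    rintro S hS T ⟨A, ⟨E, hE, hEU, hEA⟩, hAT⟩
    obtain ⟨t, ht, rfl⟩ := (mem_iInf_of_finite S).1 hS
    choose B hB hBt using ht
    choose D hD hDW hDB using hB
    have hproj : ∀ j, (fun y : H j ⊕ α → X => y ∘ Sum.inr) '' D j ∈ U := fun j =>
      (h j _ (𝔇.proj _ (hD j))).1
        (mem_restrict.2 (mem_of_superset (hDW j) (Set.subset_preimage_image _ _)))
    obtain ⟨x, hxE, hx⟩ := U.nonempty_of_mem (inter_mem hEU (iInter_mem.2 hproj))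
    rw [Set.mem_iInter] at hx
    choose y hyD hyx using hx
    refine ⟨Sum.elim (fun p => y p.1 (Sum.inl p.2)) x, Set.mem_iInter.2 fun j => hBt j ?_,
      hAT (hEA (by simpa using hxE))⟩
    refine hDB j ?_
    convert hyD j using 1
    funext i
    rcases i with i | i
    · rfl
    · exact (congrFun (hyx j) i).symm
  obtain ⟨W', hW'⟩ := Ultrafilter.exists_le ((⨅ j, comap (r j) (𝔇.typeFilter (W j))) ⊓
      comap (fun y => y ∘ Sum.inr) (𝔇.typeFilter U))
  refine ⟨W', sameType_of_le (map_le_iff_le_comap.2 (hW'.trans inf_le_right)), fun j =>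
    sameType_of_le (map_le_iff_le_comap.2 (hW'.trans (inf_le_left.trans (iInf_le _ j))))⟩

end DefStr

namespace DefStr

variable {X : Type u} {𝔇 : DefStr X}

/-- Given finitely many coheirs `V j` of the same type, there is a finite configuration of
realizations such that every colouring of it by the index set admits, for some `j`, a sequence of
length `K j` in colour `j` all of whose pairs look like coheir Morley sequences in `V j`. -/
theorem exists_ramsey_configuration {ι α : Type} [Finite ι] [Finite α]
    (V : ι → Ultrafilter (α → X)) (U : Ultrafilter (α → X)) (hV : ∀ j, 𝔇.SameType (V j) U)
    (K : ι → ℕ) :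
    ∃ (G : Type) (_ : Finite G) (W : Ultrafilter (G × α → X)),
      (∀ g, 𝔇.SameType (NSOP2Paper.restrict (Prod.mk g) W) U) ∧
      ∀ χ : G → ι, ∃ (j : ι) (g : ℕ → G), (∀ i < K j, χ (g i) = j) ∧
        ∀ i i', i < i' → i' < K j →
          𝔇.SameType (NSOP2Paper.restrict (Sum.elim (Prod.mk (g i)) (Prod.mk (g i'))) W)
            (tens (V j) (V j)) := by
  classical
  cases nonempty_fintype ι
  induction hn : ∑ j, K j using Nat.strong_induction_on generalizing K with
  | _ n ih =>
  by_cases h0 : ∃ j, K j = 0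
  · obtain ⟨j, hj⟩ := h0
    refine ⟨Unit, inferInstance, NSOP2Paper.restrict Prod.snd U, fun g => SameType.refl U,
      fun χ => ⟨j, fun _ => (), ?_, ?_⟩⟩ <;> simp [hj]
  · push Not at h0
    have hlt : ∀ j, ∑ i, Function.update K j (K j - 1) i < n := fun j => by
      rw [← hn]
      refine Finset.sum_lt_sum (fun i _ => ?_) ⟨j, Finset.mem_univ j, ?_⟩
      · rcases eq_or_ne i j with rfl | h <;> simp [*]
      · have := h0 j
        simp only [Function.update_self]
        omega
    choose G hG W hW hχ using fun j => ih _ (hlt j) (Function.update K j (K j - 1)) rfl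
    obtain ⟨W', hW'U, hW'⟩ := exists_amalgam (H := fun j => G j × α) U
      (fun j => tens (W j) (V j)) (fun j => by rw [restrict_inr_tens]; exact hV j)
    let f : Option (Σ j, G j) × α → (Σ j, G j × α) ⊕ α := fun p =>
      p.1.elim (Sum.inr p.2) fun q => Sum.inl ⟨q.1, (q.2, p.2)⟩
    refine ⟨Option (Σ j, G j), inferInstance, NSOP2Paper.restrict f W', ?_, fun χ => ?_⟩
    · rintro (_ | ⟨j, g⟩)
      · exact hW'U
      · have h := (hW' j).restrict (Sum.inl ∘ Prod.mk g)
        rw [← restrict_restrict _ Sum.inl (tens _ _), restrict_inl_tens] at h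
        exact h.trans (hW j g)
    · obtain ⟨j, g, hg, hp⟩ := hχ (χ none) fun g => χ (some ⟨χ none, g⟩)
      have key : ∀ i i', i < i' → i' < Function.update K (χ none) (K (χ none) - 1) j →
          𝔇.SameType (NSOP2Paper.restrict (Sum.elim (Prod.mk (some ⟨χ none, g i⟩))
            (Prod.mk (some ⟨χ none, g i'⟩))) (NSOP2Paper.restrict f W')) (tens (V j) (V j)) := by
        intro i i' h h'
        have := (hW' (χ none)).restrict
          (Sum.inl ∘ Sum.elim (Prod.mk (g i)) (Prod.mk (g i')))
        rw [← restrict_restrict _ Sum.inl (tens _ _), restrict_inl_tens] at this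
        convert this.trans (hp i i' h h') using 1
        rw [restrict_restrict, restrict_restrict]
        congr 1
        funext x
        rcases x with x | x <;> rfl
      rcases ne_or_eq j (χ none) with hj | hj
      · rw [Function.update_of_ne hj] at hg key
        exact ⟨j, fun i => some ⟨χ none, g i⟩, hg, key⟩
      · have hK := h0 j
        have hup : Function.update K (χ none) (K (χ none) - 1) j = K j - 1 := by
          rw [hj, Function.update_self]
        rw [hup] at hg key
        refine ⟨j, fun i => if i < K j - 1 then some ⟨χ none, g i⟩ else none, fun i hi => ?_,
          fun i i' h h' => ?_⟩
        · dsimp only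
          split_ifs with h
          · exact hg i h
          · exact hj.symm
        · have hi : i < K j - 1 := by omega
          simp only [hi, if_true]
          split_ifs with hi'
          · exact key i i' h hi'
          · have := (hW' (χ none)).restrict (Sum.map (Prod.mk (g i)) id)
            rw [restrict_map_tens] at this
            have h2 := this.trans (((hW _ (g i)).trans (hV (χ none)).symm).tens_left _)
            subst hj
            convert h2 using 1
            · rw [restrict_restrict, restrict_restrict]
              congr 1
              funext x
              rcases x with x | x <;> rfl
            · rfl

variable (𝔇) in
/-- `n`-fold approximation to being a canonical coheir: for every coheir `V` of the same type,
there is a coheir of the type of a Morley sequence of length two in `V`, good to the previous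
stage, both of whose marginals are the given coheir. -/
def Good : ℕ → ∀ {α : Type}, Ultrafilter (α → X) → Prop
  | 0, _, _ => True
  | n + 1, α, Q => ∀ V : Ultrafilter (α → X), 𝔇.SameType V Q →
      ∃ Q' : Ultrafilter (α ⊕ α → X), Good n Q' ∧ NSOP2Paper.restrict Sum.inl Q' = Q ∧
        NSOP2Paper.restrict Sum.inr Q' = Q ∧ 𝔇.SameType Q' (tens V V)

theorem Good.of_succ {n : ℕ} {α : Type} {Q : Ultrafilter (α → X)} (h : 𝔇.Good (n + 1) Q) :
    𝔇.Good n Q := by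
  induction n generalizing α with
  | zero => trivial
  | succ n ih =>
    intro V hV
    obtain ⟨Q', h₁, h₂⟩ := h V hV
    exact ⟨Q', ih h₁, h₂⟩

theorem Good.restrict {n : ℕ} {α β : Type} [Finite α] [Finite β] {Q : Ultrafilter (α → X)}
    (h : 𝔇.Good n Q) (f : β → α) : 𝔇.Good n (NSOP2Paper.restrict f Q) := by
  induction n generalizing α β with
  | zero => trivial
  | succ n ih =>
    intro V hV
    obtain ⟨V', hV'Q, rfl⟩ := exists_extension f V Q hV
    obtain ⟨Q', hg, hl, hr, ht⟩ := h V' hV'Q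
    refine ⟨NSOP2Paper.restrict (Sum.map f f) Q', ih hg _, ?_, ?_, ?_⟩
    · change NSOP2Paper.restrict (Sum.inl ∘ f) Q' = _
      rw [← restrict_restrict, hl]
    · change NSOP2Paper.restrict (Sum.inr ∘ f) Q' = _
      rw [← restrict_restrict, hr]
    · rw [← restrict_map_tens]
      exact ht.restrict _

variable (𝔇) in
/-- The good coheirs of a type. -/
def goodSet (n : ℕ) {α : Type} (U : Ultrafilter (α → X)) : Set (Ultrafilter (α → X)) :=
  {Q | 𝔇.SameType Q U ∧ 𝔇.Good n Q}

theorem isClosed_sameType {α : Type} (U : Ultrafilter (α → X)) :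
    IsClosed {Q : Ultrafilter (α → X) | 𝔇.SameType Q U} := by
  have : {Q : Ultrafilter (α → X) | 𝔇.SameType Q U} =
      ⋂ (D : Set (α → X)) (_ : 𝔇.IsDef D ∧ D ∈ U), {Q | D ∈ Q} := by
    ext Q
    simp only [Set.mem_iInter]
    exact ⟨fun h D hD => (h D hD.1).2 hD.2,
      fun h => (sameType_of_imp fun D hD hU => h D ⟨hD, hU⟩).symm⟩
  rw [this]
  exact isClosed_iInter fun D => isClosed_iInter fun _ => ultrafilter_isClosed_basic D

theorem isClosed_goodSet (n : ℕ) {α : Type} (U : Ultrafilter (α → X)) :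
    IsClosed (𝔇.goodSet n U) := by
  induction n generalizing α with
  | zero =>
    convert isClosed_sameType U using 1
    ext Q
    exact and_iff_left trivial
  | succ n ih =>
    have : 𝔇.goodSet (n + 1) U = {Q | 𝔇.SameType Q U} ∩
        ⋂ (V : Ultrafilter (α → X)) (_ : 𝔇.SameType V U),
          NSOP2Paper.restrict Sum.inl '' (𝔇.goodSet n (tens V V) ∩
            {Q' | NSOP2Paper.restrict Sum.inl Q' = NSOP2Paper.restrict Sum.inr Q'}) := by
      ext Q
      simp only [Set.mem_inter_iff, Set.mem_iInter]
      refine and_congr_right fun hQ => ⟨fun h V hV => ?_, fun h V hV => ?_⟩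
      · obtain ⟨Q', hg, hl, hr, ht⟩ := h V (hV.trans hQ.symm)
        exact ⟨Q', ⟨⟨ht, hg⟩, hl.trans hr.symm⟩, hl⟩
      · obtain ⟨Q', ⟨⟨ht, hg⟩, hlr⟩, hl⟩ := h V (hV.trans hQ)
        exact ⟨Q', hg, hl, hlr.symm.trans hl, ht⟩
    rw [this]
    refine (isClosed_sameType U).inter (isClosed_iInter fun V => isClosed_iInter fun _ => ?_)
    exact (((ih (tens V V)).inter (isClosed_eq (continuous_restrict _)
      (continuous_restrict _))).isCompact.image (continuous_restrict _)).isClosed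

/-- A finite approximation to the existence of good coheirs. -/
theorem exists_monochromatic_pairs {n : ℕ}
    (ih : ∀ {α : Type} [Finite α] (U : Ultrafilter (α → X)), (𝔇.goodSet n U).Nonempty)
    {ι α : Type} [Finite ι] [Finite α] (V : ι → Ultrafilter (α → X)) (U : Ultrafilter (α → X))
    (hV : ∀ j, 𝔇.SameType (V j) U) (Δ : Finset (Set (α → X))) :
    ∃ (c : Set Δ) (Q' : ι → Ultrafilter (α ⊕ α → X)), ∀ j, Q' j ∈ 𝔇.goodSet n (tens (V j) (V j)) ∧
      ∀ A : Δ, ((A : Set (α → X)) ∈ NSOP2Paper.restrict Sum.inl (Q' j) ↔ A ∈ c) ∧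
        ((A : Set (α → X)) ∈ NSOP2Paper.restrict Sum.inr (Q' j) ↔ A ∈ c) := by
  obtain ⟨G, _, W, hW, hχ⟩ := exists_ramsey_configuration V U hV
    fun _ => Nat.card (Set Δ) + 1
  obtain ⟨R, hR, hgood⟩ := ih W
  let c : G → Set Δ := fun g => {A | (A : Set (α → X)) ∈ NSOP2Paper.restrict (Prod.mk g) R}
  have main : ∃ c₀ : Set Δ, ∀ j, ∃ g g', c g = c₀ ∧ c g' = c₀ ∧
      𝔇.SameType (NSOP2Paper.restrict (Sum.elim (Prod.mk g) (Prod.mk g')) W)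
        (tens (V j) (V j)) := by
    by_contra! hcon
    choose j hj using hcon
    obtain ⟨i, g, hg, hp⟩ := hχ fun g => j (c g)
    have hni : ¬ Function.Injective fun a : Fin (Nat.card (Set Δ) + 1) => c (g a) := by
      intro hinj
      have := Nat.card_le_card_of_injective _ hinj
      simp at this
    obtain ⟨a, b, hab, hne⟩ : ∃ a b : Fin (Nat.card (Set Δ) + 1), c (g a) = c (g b) ∧ a < b := by
      rw [Function.not_injective_iff] at hni
      obtain ⟨a, b, hab, hne⟩ := hni
      rcases lt_or_gt_of_ne hne with h | h
      · exact ⟨a, b, hab, h⟩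
      · exact ⟨b, a, hab.symm, h⟩
    refine hj (c (g a)) (g a) (g b) rfl hab.symm ?_
    rw [hg a a.2]
    exact hp a b hne b.2
  obtain ⟨c₀, h⟩ := main
  choose g g' hg hg' hs using h
  refine ⟨c₀, fun j => NSOP2Paper.restrict (Sum.elim (Prod.mk (g j)) (Prod.mk (g' j))) R,
    fun j => ⟨⟨(hR.restrict _).trans (hs j), hgood.restrict _⟩, fun A => ⟨?_, ?_⟩⟩⟩
  · rw [← hg j, restrict_restrict, Sum.elim_comp_inl]
    rfl
  · rw [← hg' j, restrict_restrict, Sum.elim_comp_inr]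
    rfl

theorem goodSet_nonempty (n : ℕ) {α : Type} [Finite α] (U : Ultrafilter (α → X)) :
    (𝔇.goodSet n U).Nonempty := by
  classical
  induction n generalizing α with
  | zero => exact ⟨U, SameType.refl U, trivial⟩
  | succ n ih =>
    let Vs := {V : Ultrafilter (α → X) // 𝔇.SameType V U}
    let s : Bool → α → α ⊕ α := fun a => if a then Sum.inr else Sum.inl
    let Z : (Vs × Bool) × (Vs × Bool) × Set (α → X) → Set (Vs → Ultrafilter (α ⊕ α → X)) :=
      fun p => {Q | p.2.2 ∈ NSOP2Paper.restrict (s p.1.2) (Q p.1.1) ↔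
        p.2.2 ∈ NSOP2Paper.restrict (s p.2.1.2) (Q p.2.1.1)}
    have hZ : ∀ p, IsClosed (Z p) := by
      rintro ⟨⟨V, a⟩, ⟨V', a'⟩, A⟩
      have hclopen : ∀ (V : Vs) (a : Bool), IsClopen
          {Q : Vs → Ultrafilter (α ⊕ α → X) | A ∈ NSOP2Paper.restrict (s a) (Q V)} := fun V a =>
        ⟨(ultrafilter_isClosed_basic A).preimage
            ((continuous_restrict (s a)).comp (continuous_apply V)),
          (ultrafilter_isOpen_basic A).preimage
            ((continuous_restrict (s a)).comp (continuous_apply V))⟩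
      have : Z ((V, a), (V', a'), A) =
          ({Q | A ∈ NSOP2Paper.restrict (s a) (Q V)} ∩
            {Q | A ∈ NSOP2Paper.restrict (s a') (Q V')}) ∪
          ({Q | A ∈ NSOP2Paper.restrict (s a) (Q V)}ᶜ ∩
            {Q | A ∈ NSOP2Paper.restrict (s a') (Q V')}ᶜ) := by
        ext Q
        exact iff_iff_and_or_not_and_not
      rw [this]
      exact (((hclopen V a).inter (hclopen V' a')).union
        ((hclopen V a).compl.inter (hclopen V' a').compl)).isClosed
    have hcomp : IsCompact (Set.univ.pi fun V : Vs => 𝔇.goodSet n (tens V.1 V.1)) :=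
      isCompact_univ_pi fun V => (isClosed_goodSet n _).isCompact
    obtain ⟨Q, hQ, hQZ⟩ := hcomp.inter_iInter_nonempty Z hZ fun u => by
      let S : Finset Vs := u.image (fun p => p.1.1) ∪ u.image fun p => p.2.1.1
      obtain ⟨N, ⟨σ⟩⟩ := Finite.exists_equiv_fin S
      obtain ⟨c, Q', hQ'⟩ := exists_monochromatic_pairs (𝔇 := 𝔇) ih
        (fun j : Fin N => (σ.symm j).1.1) U
        (fun j => (σ.symm j).1.2) (u.image fun p => p.2.2)
      choose R hR using fun V : Vs => ih (tens V.1 V.1)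
      let Q : Vs → Ultrafilter (α ⊕ α → X) := fun V => if h : V ∈ S then Q' (σ ⟨V, h⟩) else R V
      have hQin : ∀ V (h : V ∈ S), Q V = Q' (σ ⟨V, h⟩) := fun V h => dif_pos h
      refine ⟨Q, fun V _ => ?_, Set.mem_iInter₂.2 fun p hp => ?_⟩
      · by_cases h : V ∈ S
        · rw [hQin V h]
          simpa using (hQ' (σ ⟨V, h⟩)).1
        · simp only [Q, dif_neg h]
          exact hR V
      · obtain ⟨⟨V, a⟩, ⟨V', a'⟩, A⟩ := p
        have hV : V ∈ S := Finset.mem_union_left _ (Finset.mem_image.2 ⟨_, hp, rfl⟩)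
        have hV' : V' ∈ S := Finset.mem_union_right _ (Finset.mem_image.2 ⟨_, hp, rfl⟩)
        have hA : A ∈ u.image fun p => p.2.2 := Finset.mem_image.2 ⟨_, hp, rfl⟩
        have aux : ∀ (V : Vs) (h : V ∈ S) (a : Bool),
            A ∈ NSOP2Paper.restrict (s a) (Q V) ↔ ⟨A, hA⟩ ∈ c := fun V h a => by
          rw [hQin V h]
          cases a
          · exact ((hQ' _).2 ⟨A, hA⟩).1
          · exact ((hQ' _).2 ⟨A, hA⟩).2
        exact (aux V hV a).trans (aux V' hV' a').symm
    have heq : ∀ (V V' : Vs) (a a' : Bool),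
        NSOP2Paper.restrict (s a) (Q V) = NSOP2Paper.restrict (s a') (Q V') := fun V V' a a' =>
      Ultrafilter.ext fun A => Set.mem_iInter.1 hQZ ((V, a), (V', a'), A)
    let V₀ : Vs := ⟨U, SameType.refl U⟩
    have hU : 𝔇.SameType (NSOP2Paper.restrict Sum.inl (Q V₀)) U := by
      have := (hQ V₀ trivial).1.restrict Sum.inl
      rwa [restrict_inl_tens] at this
    refine ⟨NSOP2Paper.restrict Sum.inl (Q V₀), hU, fun V hV => ?_⟩
    let V₁ : Vs := ⟨V, hV.trans hU⟩
    exact ⟨Q V₁, (hQ V₁ trivial).2, heq V₁ V₀ false false, heq V₁ V₀ true false,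
      (hQ V₁ trivial).1⟩

/-- Every type has a coheir which is good to all finite stages. -/
theorem exists_good {α : Type} [Finite α] (U : Ultrafilter (α → X)) :
    ∃ Q : Ultrafilter (α → X), 𝔇.SameType Q U ∧ ∀ n, 𝔇.Good n Q := by
  obtain ⟨Q, hQ⟩ := IsCompact.nonempty_iInter_of_sequence_nonempty_isCompact_isClosed
    (fun n => 𝔇.goodSet n U) (fun n Q h => ⟨h.1, h.2.of_succ⟩) (fun n => goodSet_nonempty n U)
    (isClosed_goodSet 0 U).isCompact fun n => isClosed_goodSet n U
  rw [Set.mem_iInter] at hQ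
  exact ⟨Q, (hQ 0).1, fun n => (hQ n).2⟩

end DefStr

end Ultrafilters

section Combs

variable {A : Type w} [DecidableEq A]

theorem meet_prefix_left (x y : List A) : meet x y <+: x := by
  induction x generalizing y with
  | nil => cases y <;> exact List.nil_prefix
  | cons a x ih =>
    cases y with
    | nil => exact List.nil_prefix
    | cons b y =>
      simp only [meet]
      split_ifs
      · exact (List.prefix_cons_inj a).2 (ih y)
      · exact List.nil_prefix

theorem meet_prefix_right (x y : List A) : meet x y <+: y := by
  induction x generalizing y with
  | nil => cases y <;> exact List.nil_prefix
  | cons a x ih =>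
    cases y with
    | nil => exact List.nil_prefix
    | cons b y =>
      simp only [meet]
      split_ifs with h
      · subst h
        exact (List.prefix_cons_inj a).2 (ih y)
      · exact List.nil_prefix

theorem foldl_meet_prefix (ls : List (List A)) (x : List A) :
    ls.foldl meet x <+: x ∧ ∀ y ∈ ls, ls.foldl meet x <+: y := by
  induction ls generalizing x with
  | nil => simp
  | cons z ls ih =>
    obtain ⟨h₁, h₂⟩ := ih (meet x z)
    refine ⟨h₁.trans (meet_prefix_left x z), fun y hy => ?_⟩
    rcases List.mem_cons.1 hy with rfl | hy
    · exact h₁.trans (meet_prefix_right x y)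
    · exact h₂ y hy

theorem foldl_meet_cons (a : A) (ls : List (List A)) (x : List A) :
    (ls.map (List.cons a)).foldl meet (a :: x) = a :: ls.foldl meet x := by
  induction ls generalizing x with
  | nil => rfl
  | cons z ls ih => simp [meet, ih]

theorem combMeet_prefix {k : ℕ} (η : Fin k → List A) {i j : Fin k} (h : j ≤ i) :
    combMeet η i <+: η j := by
  rcases h.eq_or_lt with rfl | h
  · exact (foldl_meet_prefix _ _).1
  · exact (foldl_meet_prefix _ _).2 _ (List.mem_ofFn.2 ⟨⟨j, h⟩, rfl⟩)

theorem combMeet_cons {k : ℕ} (a : A) (η : Fin k → List A) (i : Fin k) :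
    combMeet (fun j => a :: η j) i = a :: combMeet η i := by
  rw [combMeet, combMeet, ← foldl_meet_cons, List.map_ofFn]
  rfl

theorem DescendingComb.of_cons [LT A] [Std.Irrefl ((· < ·) : A → A → Prop)] {k : ℕ} {a : A}
    {η : Fin k → List A} (h : DescendingComb fun j => a :: η j) : DescendingComb η := by
  refine ⟨fun i j hij hp => h.1 i j hij ((List.prefix_cons_inj a).2 hp), fun i j hij => ?_,
    fun i hi => ?_⟩
  · exact List.lex_cons_iff.1 (h.2.1 i j hij)
  · have := h.2.2 i hi
    rwa [combMeet_cons, combMeet_cons, List.prefix_cons_inj, Ne, List.cons_inj_right] at this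

theorem DescendingComb.castSucc [LT A] {k : ℕ} {η : Fin (k + 1) → List A}
    (h : DescendingComb η) : DescendingComb fun i : Fin k => η i.castSucc :=
  ⟨fun i j hij => h.1 _ _ (by simpa [Fin.castSucc_inj] using hij),
    fun i j hij => h.2.1 _ _ (by simpa using hij), fun i hi => h.2.2 i (by omega)⟩

/-- A descending comb with at least two elements either lies above an immediate successor of the
root, or its last element lies above the second successor of the root, and all others lie above
the first one. -/
theorem DescendingComb.cons_or {l : ℕ} {η : Fin (l + 2) → List Bool} (h : DescendingComb η) :
    (∃ (a : Bool) (ν : Fin (l + 2) → List Bool), ∀ i, η i = a :: ν i) ∨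
      ∃ (ν : Fin (l + 1) → List Bool) (τ : List Bool), (∀ i, η i.castSucc = false :: ν i) ∧
        η (Fin.last _) = true :: τ := by
  have hne : ∀ i, ∃ a x, η i = a :: x := fun i => by
    rcases hi : η i with _ | ⟨a, x⟩
    · obtain ⟨j, hj⟩ := exists_ne i
      exact absurd (hi ▸ List.nil_prefix) (h.1 i j hj.symm)
    · exact ⟨a, x, rfl⟩
  choose a ν hη using hne
  have hmono : ∀ i j, i < j → a i = true → a j = true := fun i j hij hi => by
    have := h.2.1 i j hij
    rw [hη i, hη j, hi] at this
    by_contra hj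
    rw [Bool.not_eq_true] at hj
    rw [hj] at this
    cases this with
    | rel h => exact absurd h (by decide)
  by_cases h0 : a 0 = true
  · refine Or.inl ⟨true, ν, fun i => ?_⟩
    rcases eq_or_ne i 0 with rfl | hi
    · rw [hη, h0]
    · rw [hη, hmono 0 i (Fin.pos_of_ne_zero hi) h0]
  · have h0' : a 0 = false := by simpa using h0
    have hinit : ∀ i : Fin (l + 1), a i.castSucc = false := fun i => by
      by_contra hi
      have hi' : a i.castSucc = true := by simpa using hi
      have h₁ : combMeet η i.castSucc <+: false :: ν 0 := by
        rw [← h0', ← hη]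
        exact combMeet_prefix η (Fin.zero_le _)
      have h₂ : combMeet η i.castSucc <+: true :: ν i.castSucc := by
        rw [← hi', ← hη]
        exact combMeet_prefix η le_rfl
      have hnil : combMeet η i.castSucc = [] := by
        rcases hc : combMeet η i.castSucc with _ | ⟨c, x⟩
        · rfl
        · rw [hc, List.cons_prefix_cons] at h₁ h₂
          exact absurd (h₁.1.symm.trans h₂.1) (by decide)
      obtain ⟨hp, hn⟩ := h.2.2 i (by omega)
      change _ <+: combMeet η i.castSucc at hp
      change _ ≠ combMeet η i.castSucc at hn
      rw [hnil] at hp hn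
      exact hn (List.prefix_nil.1 hp)
    rcases hl : a (Fin.last _) with _ | _
    · refine Or.inl ⟨false, ν, fun i => ?_⟩
      induction i using Fin.lastCases with
      | last => rw [hη, hl]
      | cast i => rw [hη, hinit]
    · exact Or.inr ⟨fun i => ν i.castSucc, ν (Fin.last _), fun i => by rw [hη, hinit],
        by rw [hη, hl]⟩

/-- The elements of a strictly decreasing chain of nonempty sequences have a common first entry. -/
theorem exists_cons_of_chain {l : ℕ} {η : Fin (l + 1) → List Bool}
    (h : ∀ i j, i < j → η j <+: η i) (hne : η (Fin.last l) ≠ []) :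
    ∃ (a : Bool) (ν : Fin (l + 1) → List Bool), ∀ i, η i = a :: ν i := by
  obtain ⟨a, x, hx⟩ := List.exists_cons_of_ne_nil hne
  have : ∀ i, ∃ y, η i = a :: y := fun i => by
    rcases (Fin.le_last i).eq_or_lt with rfl | hi
    · exact ⟨x, hx⟩
    · obtain ⟨y, hy⟩ := h i _ hi
      exact ⟨x ++ y, by rw [← hy, hx]; rfl⟩
  choose ν hν using this
  exact ⟨a, ν, hν⟩

end Combs

/-- Index set for binary trees of height `N`. -/
def TreeIdx : ℕ → Type
  | 0 => Unit
  | N + 1 => Option (Bool × TreeIdx N)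

instance : ∀ N, Finite (TreeIdx N)
  | 0 => inferInstanceAs (Finite Unit)
  | N + 1 =>
    have : Finite (TreeIdx N) := instFiniteTreeIdx N
    inferInstanceAs (Finite (Option (Bool × TreeIdx N)))

/-- The root of a binary tree of positive height. -/
def TreeIdx.root (N : ℕ) : TreeIdx (N + 1) :=
  none

/-- A node above an immediate successor of the root. -/
def TreeIdx.sub {N : ℕ} (p : Bool × TreeIdx N) : TreeIdx (N + 1) :=
  some p

/-- The node of the binary tree of height `N` given by a sequence of length at most `N`. -/
def TreeIdx.node : ∀ N, List Bool → TreeIdx N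
  | 0, _ => ()
  | N + 1, [] => root N
  | N + 1, a :: x => sub (a, node N x)

/-- The type of a coheir Morley sequence of length `l`. -/
def power {X : Type u} (V : Ultrafilter (Fin 1 → X)) : ∀ l : ℕ, Ultrafilter (Fin l → X)
  | 0 => restrict Fin.elim0 V
  | l + 1 => restrict (Fin.snoc Sum.inl (Sum.inr 0) : Fin (l + 1) → Fin l ⊕ Fin 1)
      (tens (power V l) V)

namespace DefStr

variable {X : Type u} {𝔇 : DefStr X}

theorem ultrafilter_fin_zero_eq (U V : Ultrafilter (Fin 0 → X)) : U = V := by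
  refine Ultrafilter.ext fun S => ?_
  rcases S.eq_empty_or_nonempty with rfl | h
  · exact iff_of_false Ultrafilter.empty_notMem Ultrafilter.empty_notMem
  · rw [Subsingleton.eq_univ_of_nonempty h]
    exact iff_of_true Filter.univ_mem Filter.univ_mem

theorem power_one (V : Ultrafilter (Fin 1 → X)) : power V 1 = V := by
  have : (Fin.snoc Sum.inl (Sum.inr 0) : Fin 1 → Fin 0 ⊕ Fin 1) = Sum.inr := by
    funext i
    rw [Fin.fin_one_eq_zero i]
    exact Fin.snoc_last (α := fun _ => Fin 0 ⊕ Fin 1) _ _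
  rw [power, this, restrict_inr_tens]

theorem sameType_power_succ {G H : Type} {W : Ultrafilter (H → X)} {s : G → H} {t : H}
    {W₀ : Ultrafilter (G → X)} {V : Ultrafilter (Fin 1 → X)}
    (h : 𝔇.SameType (NSOP2Paper.restrict (Sum.elim s fun _ : Fin 1 => t) W) (tens W₀ V))
    {l : ℕ} {f : Fin l → G} (hf : 𝔇.SameType (NSOP2Paper.restrict f W₀) (power V l))
    {η : Fin (l + 1) → H} (hη : ∀ i, η (Fin.castSucc i) = s (f i)) (hl : η (Fin.last l) = t) :
    𝔇.SameType (NSOP2Paper.restrict η W) (power V (l + 1)) := by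
  have h₁ := h.restrict (Sum.map f id)
  rw [restrict_map_tens] at h₁
  have h₂ := (h₁.trans (hf.tens_left V)).restrict
    (Fin.snoc Sum.inl (Sum.inr 0) : Fin (l + 1) → Fin l ⊕ Fin 1)
  rw [restrict_restrict, restrict_restrict] at h₂
  rw [show NSOP2Paper.restrict η W = NSOP2Paper.restrict _ W from restrict_congr (fun i => ?_) W]
  · exact h₂
  induction i using Fin.lastCases with
  | last => simp [hl]
  | cast i => simp [hη]

variable (𝔇) in
/-- A type of binary trees whose nodes realize `U`, whose descending combs are coheir Morley
sequences in `U`, and whose paths, read downwards, are coheir Morley sequences in `V`. -/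
structure IsCombTree (U V : Ultrafilter (Fin 1 → X)) (N : ℕ)
    (W : Ultrafilter (TreeIdx N → X)) : Prop where
  node : ∀ t, NSOP2Paper.restrict (fun _ : Fin 1 => t) W = U
  path : ∀ (l : ℕ) (η : Fin l → List Bool), (∀ i, (η i).length ≤ N) →
    (∀ i j, i < j → η j <+: η i ∧ η j ≠ η i) →
    𝔇.SameType (NSOP2Paper.restrict (fun i => TreeIdx.node N (η i)) W) (power V l)
  comb : ∀ (l : ℕ) (η : Fin l → List Bool), (∀ i, (η i).length ≤ N) → DescendingComb η →
    𝔇.SameType (NSOP2Paper.restrict (fun i => TreeIdx.node N (η i)) W) (power U l)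

section Step

variable {U V : Ultrafilter (Fin 1 → X)} {N : ℕ} {W : Ultrafilter (TreeIdx N → X)}
  {W' : Ultrafilter (TreeIdx (N + 1) → X)}

/-- Two copies of a comb tree, independent of each other, together with a root. -/
theorem IsCombTree.succ (hW : 𝔇.IsCombTree U V N W)
    (hsub : ∀ a : Bool, NSOP2Paper.restrict (fun t => TreeIdx.sub (a, t)) W' = W)
    (hlr : 𝔇.SameType (NSOP2Paper.restrict (Sum.elim (fun t => TreeIdx.sub (false, t))
      fun t => TreeIdx.sub (true, t)) W') (tens W W))
    (hroot : 𝔇.SameType (NSOP2Paper.restrict (Sum.elim TreeIdx.sub fun _ : Fin 1 => TreeIdx.root N) W')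
      (tens (NSOP2Paper.restrict TreeIdx.sub W') V))
    (hnode : NSOP2Paper.restrict (fun _ : Fin 1 => TreeIdx.root N) W' = U) :
    𝔇.IsCombTree U V (N + 1) W' := by
  have hnode' : ∀ t, NSOP2Paper.restrict (fun _ : Fin 1 => t) W' = U := by
    rintro (_ | ⟨a, t⟩)
    · exact hnode
    · rw [← hW.node t, ← hsub a]
      rfl
  refine ⟨hnode', fun l η hlen hη => ?_, fun l η hlen hη => ?_⟩
  · rcases l with _ | l
    · rw [ultrafilter_fin_zero_eq (NSOP2Paper.restrict _ _) (power V 0)]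
      exact SameType.refl _
    have aux : ∀ (l : ℕ) (η : Fin l → List Bool) (a : Bool) (ν : Fin l → List Bool),
        (∀ i, η i = a :: ν i) → (∀ i, (η i).length ≤ N + 1) →
        (∀ i j, i < j → η j <+: η i ∧ η j ≠ η i) →
        𝔇.SameType (NSOP2Paper.restrict (fun i => TreeIdx.node N (ν i)) W) (power V l) := by
      intro l η a ν hν hlen hη
      refine hW.path l ν (fun i => by simpa [hν] using hlen i) fun i j hij => ?_
      simpa [hν, List.prefix_cons_inj] using hη i j hij
    by_cases hl : η (Fin.last l) = []
    · have : ∃ (a : Bool) (ν : Fin l → List Bool), ∀ i, η i.castSucc = a :: ν i := by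
        rcases l with _ | l
        · exact ⟨true, Fin.elim0, fun i => i.elim0⟩
        · refine exists_cons_of_chain (η := fun i : Fin (l + 1) => η i.castSucc)
            (fun i j hij => (hη _ _ (by simpa using hij)).1) fun h => ?_
          exact (hη (Fin.last l).castSucc (Fin.last _) (Fin.castSucc_lt_last _)).2 (by rw [hl, h])
      obtain ⟨a, ν, hν⟩ := this
      refine sameType_power_succ hroot (f := fun i => (a, TreeIdx.node N (ν i))) ?_
        (fun i => by rw [hν]; rfl) (by rw [hl]; rfl)
      have h := aux l (fun i => η i.castSucc) a ν hν (fun i => hlen _)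
        fun i j hij => hη _ _ (by simpa using hij)
      rw [← hsub a] at h
      exact h
    · obtain ⟨a, ν, hν⟩ := exists_cons_of_chain (fun i j hij => (hη i j hij).1) hl
      have h := aux _ η a ν hν hlen hη
      rw [← hsub a] at h
      simp only [hν]
      exact h
  · rcases l with _ | _ | l
    · rw [ultrafilter_fin_zero_eq (NSOP2Paper.restrict _ _) (power U 0)]
      exact SameType.refl _
    · rw [power_one, ← hnode' (TreeIdx.node (N + 1) (η 0))]
      convert SameType.refl _ using 3 with i
      rw [Fin.fin_one_eq_zero i]
    rcases hη.cons_or with ⟨a, ν, hν⟩ | ⟨ν, τ, hν, hτ⟩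
    · have hη' : DescendingComb ν := by
        rw [funext hν] at hη
        exact hη.of_cons
      have h := hW.comb _ ν (fun i => by simpa [hν] using hlen i) hη'
      rw [← hsub a] at h
      simp only [hν]
      exact h
    · have hη' : DescendingComb ν := by
        have := hη.castSucc
        simp only [hν] at this
        exact this.of_cons
      have h₁ := hlr.restrict (Sum.map id fun _ : Fin 1 => TreeIdx.node N τ)
      rw [restrict_restrict, restrict_map_tens, hW.node, restrict_id] at h₁
      refine sameType_power_succ (s := fun t => TreeIdx.sub (false, t))
        (t := TreeIdx.sub (true, TreeIdx.node N τ)) (W₀ := W) (f := fun i => TreeIdx.node N (ν i)) ?_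
        (hW.comb _ ν (fun i => by
          have := hlen i.castSucc
          rw [hν] at this
          simpa using this) hη')
        (fun i => by rw [hν]; rfl) (by rw [hτ]; rfl)
      convert h₁ using 1
      refine restrict_congr (fun x => ?_) W'
      rcases x with x | x <;> rfl

end Step

theorem exists_isCombTree {U V : Ultrafilter (Fin 1 → X)} (hVU : 𝔇.SameType V U)
    (hU : ∀ n, 𝔇.Good n U) (N n : ℕ) :
    ∃ W : Ultrafilter (TreeIdx N → X), 𝔇.Good n W ∧ 𝔇.IsCombTree U V N W := by
  induction N generalizing n with
  | zero =>
    have hnode : ∀ t : TreeIdx 0, NSOP2Paper.restrict (fun _ : Fin 1 => t)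
        (NSOP2Paper.restrict (fun _ : TreeIdx 0 => (0 : Fin 1)) U) = U := fun t => by
      rw [restrict_restrict]
      exact restrict_congr (fun i => (Fin.fin_one_eq_zero i).symm) U
    have aux : ∀ (V : Ultrafilter (Fin 1 → X)), 𝔇.SameType U V → ∀ (l : ℕ), l ≤ 1 →
        ∀ f : Fin l → TreeIdx 0, 𝔇.SameType (NSOP2Paper.restrict f
          (NSOP2Paper.restrict (fun _ : TreeIdx 0 => (0 : Fin 1)) U)) (power V l) := by
      intro V hV l hl f
      rcases l with _ | _ | l
      · rw [ultrafilter_fin_zero_eq (NSOP2Paper.restrict _ _) (power V 0)]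
        exact SameType.refl _
      · rw [power_one]
        refine SameType.trans ?_ hV
        convert SameType.refl _ using 1
        exact (hnode ()).symm
      · omega
    refine ⟨NSOP2Paper.restrict (fun _ => (0 : Fin 1)) U, (hU n).restrict _, hnode,
      fun l η hlen hη => aux V hVU.symm l ?_ _, fun l η hlen hη => aux U (SameType.refl U) l ?_ _⟩
    · by_contra! hl
      have := hη ⟨0, by omega⟩ ⟨1, hl⟩ (by simp)
      simp only [nonpos_iff_eq_zero, List.length_eq_zero_iff] at hlen
      exact this.2 (by rw [hlen, hlen])
    · by_contra! hl
      have := hη.1 ⟨0, by omega⟩ ⟨1, hl⟩ (by simp)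
      simp only [nonpos_iff_eq_zero, List.length_eq_zero_iff] at hlen
      exact this (by rw [hlen, hlen])
  | succ N ih =>
    obtain ⟨W, hgood, hW⟩ := ih (n + 2)
    obtain ⟨W₂, hgood₂, hl, hr, h₂⟩ := hgood W (SameType.refl W)
    let s₀ : TreeIdx N ⊕ TreeIdx N := Sum.inl (TreeIdx.node N [])
    have hs₀ : NSOP2Paper.restrict (fun _ : Fin 1 => s₀) W₂ = U := by
      rw [← hW.node (TreeIdx.node N []), ← hl]
      rfl
    obtain ⟨V', hV'W₂, hV'⟩ := exists_extension (𝔇 := 𝔇) (fun _ : Fin 1 => s₀) V W₂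
      (hs₀.symm ▸ hVU)
    obtain ⟨W₃, hgood₃, hl₃, hr₃, h₃⟩ := hgood₂ V' hV'W₂
    let i : Bool × TreeIdx N → TreeIdx N ⊕ TreeIdx N := fun p =>
      if p.1 then Sum.inr p.2 else Sum.inl p.2
    let g : TreeIdx (N + 1) → (TreeIdx N ⊕ TreeIdx N) ⊕ (TreeIdx N ⊕ TreeIdx N) := fun o =>
      Option.elim o (Sum.inr s₀) fun p => Sum.inl (i p)
    refine ⟨NSOP2Paper.restrict g W₃, hgood₃.restrict g, hW.succ ?_ ?_ ?_ ?_⟩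
    · rintro (_ | _)
      · rw [← hl, ← hl₃]
        rfl
      · rw [← hr, ← hl₃]
        rfl
    · convert h₂ using 1
      rw [← hl₃]
      exact restrict_congr (fun x => by rcases x with x | x <;> rfl) W₃
    · have h₄ := h₃.restrict (Sum.map i fun _ : Fin 1 => s₀)
      rw [restrict_map_tens, hV'] at h₄
      have h₅ := h₄.trans ((hV'W₂.restrict i).tens_left V)
      rw [← hl₃] at h₅
      convert h₅ using 1
      · exact restrict_congr (fun x => by rcases x with x | x <;> rfl) W₃
      · rfl
    · rw [← hs₀, ← hr₃]
      rfl

end DefStr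

section ModelTheory

open Filter

variable {L : FirstOrder.Language.{u, u}}

theorem definable_univ_iff {M : Type u} [L.Structure M] {β : Type v} {D : Set (β → M)} :
    (Set.univ : Set M).Definable L D ↔
      ∃ (n : ℕ) (φ : L.Formula (β ⊕ Fin n)) (c : Fin n → M), D = {y | φ.Realize (Sum.elim y c)} := by
  classical
  rw [Set.definable_iff_exists_formula_sum]
  constructor
  · rintro ⟨φ, rfl⟩
    let e := φ.freeVarFinset.toLeft.equivFin
    refine ⟨_, φ.restrictFreeVar fun x => Sum.casesOn x.1
      (fun x hx => Sum.inr (e ⟨x, by simpa using hx⟩)) (fun x _ => Sum.inl x) x.2,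
      fun i => (e.symm i).1.1, ?_⟩
    ext y
    refine (BoundedFormula.realize_restrictFreeVar _ ?_).symm
    rintro ⟨x | x, hx⟩ <;> simp
  · rintro ⟨n, φ, c, rfl⟩
    refine ⟨φ.relabel (Sum.elim Sum.inr fun i => Sum.inl ⟨c i, trivial⟩), ?_⟩
    ext y
    simp only [Set.mem_ofPred_eq, Formula.realize_relabel]
    refine iff_of_eq (congrArg _ ?_)
    funext x
    rcases x with x | x <;> rfl

variable (L) in
/-- The first-order definability structure on `m`-tuples from a structure. -/
def definableStr (M : Type u) [L.Structure M] (m : ℕ) : DefStr (Fin m → M) where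
  IsDef {F} D := (Set.univ : Set M).Definable L
    ((fun (y : F × Fin m → M) i j => y (i, j)) ⁻¹' D)
  univ F := Set.definable_univ
  compl h := h.compl
  inter h h' := h.inter h'
  reindex f _ h := h.preimage_comp (Prod.map f id)
  proj f D h := by
    convert h.image_comp (Prod.map f id) using 1
    ext y
    constructor
    · rintro ⟨z, hz, hzy⟩
      refine ⟨fun p => z p.1 p.2, hz, ?_⟩
      funext p
      exact congrFun (congrFun hzy p.1) p.2
    · rintro ⟨z, hz, rfl⟩
      exact ⟨_, hz, rfl⟩
  slice {F G D} c h := by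
    rw [Set.definable_iff_exists_formula_sum] at h ⊢
    obtain ⟨φ, hφ⟩ := h
    refine ⟨φ.relabel (Sum.elim Sum.inl fun p => Sum.elim (fun x => Sum.inr (x, p.2))
      (fun g => Sum.inl ⟨c g p.2, trivial⟩) p.1), ?_⟩
    ext y
    have := Set.ext_iff.1 hφ fun p => Sum.elim (fun x k => y (x, k)) c p.1 p.2
    refine Iff.trans ?_ (this.trans ?_)
    · refine iff_of_eq (congrArg (· ∈ D) ?_)
      funext p k
      rcases p with p | p <;> rfl
    · simp only [Set.mem_ofPred_eq, Formula.realize_relabel]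
      refine iff_of_eq (congrArg _ ?_)
      funext p
      rcases p with p | ⟨p | p, k⟩ <;> rfl

variable {𝕄 : Type u} [L.Structure 𝕄] {S : L.ElementarySubstructure 𝕄} {m : ℕ}

theorem isDef_realize {F : Type} {γ : Type v} (φ : L.Formula ((F × Fin m) ⊕ γ)) (c : γ → S) :
    (definableStr L S m).IsDef {y : F → Fin m → S |
      φ.Realize (Sum.elim (fun p => (y p.1 p.2 : 𝕄)) fun i => (c i : 𝕄))} := by
  refine Set.definable_iff_exists_formula_sum.2
    ⟨φ.relabel (Sum.elim Sum.inr fun i => Sum.inl ⟨c i, trivial⟩), ?_⟩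
  ext y
  simp only [Set.mem_preimage, Set.mem_ofPred_eq, Formula.realize_relabel]
  rw [← S.subtype.map_formula]
  refine iff_of_eq (congrArg _ ?_)
  funext p
  rcases p with p | p <;> rfl

theorem exists_formula_of_isDef {F : Type} {D : Set (F → Fin m → S)}
    (hD : (definableStr L S m).IsDef D) :
    ∃ (n : ℕ) (φ : L.Formula ((F × Fin m) ⊕ Fin n)) (c : Fin n → S), ∀ y, y ∈ D ↔
      φ.Realize (Sum.elim (fun p => (y p.1 p.2 : 𝕄)) fun i => (c i : 𝕄)) := by
  obtain ⟨n, φ, c, h⟩ := definable_univ_iff.1 hD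
  refine ⟨n, φ, c, fun y => (Set.ext_iff.1 h fun p => y p.1 p.2).trans ?_⟩
  simp only [Set.mem_ofPred_eq]
  rw [← S.subtype.map_formula]
  refine iff_of_eq (congrArg _ ?_)
  funext p
  rcases p with p | p <;> rfl

/-- A formula with parameters holds on almost all tuples of the submodel. -/
def EventuallyRealizes (V : Ultrafilter (Fin 1 → Fin m → S)) (p : FmlP L 𝕄 (Fin m)) : Prop :=
  ∀ᶠ y in (V : Filter (Fin 1 → Fin m → S)), p.2.1.Realize (Sum.elim (fun i => (y 0 i : 𝕄)) p.2.2)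

theorem exists_ultrafilter (Γ : Set (FmlP L 𝕄 (Fin m)))
    (h : ∀ t : Finset (FmlP L 𝕄 (Fin m)), ↑t ⊆ Γ → ∃ a : Fin m → S, ∀ p ∈ t,
      p.2.1.Realize (Sum.elim (fun i => (a i : 𝕄)) p.2.2)) :
    ∃ V : Ultrafilter (Fin 1 → Fin m → S), ∀ p ∈ Γ, EventuallyRealizes V p := by
  classical
  obtain ⟨V, hV⟩ := Ultrafilter.exists_ultrafilter_of_finite_inter_nonempty
    ((fun p : FmlP L 𝕄 (Fin m) => {y : Fin 1 → Fin m → S |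
      p.2.1.Realize (Sum.elim (fun i => (y 0 i : 𝕄)) p.2.2)}) '' Γ) fun T hT => by
    obtain ⟨t, ht, rfl⟩ := Finset.subset_set_image_iff.1 hT
    obtain ⟨a, ha⟩ := h t ht
    refine ⟨fun _ => a, ?_⟩
    rintro _ hA
    obtain ⟨p, hp, rfl⟩ := Finset.mem_image.1 hA
    exact ha p hp
  exact ⟨V, fun p hp => hV ⟨p, hp, rfl⟩⟩

/-- An elementary submodel satisfies the finite parts of the type of a tuple over it. -/
theorem exists_realization_in_submodel (b : Fin m → 𝕄) (t : Finset (FmlP L 𝕄 (Fin m)))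
    (hS : ∀ p ∈ t, ∀ i, p.2.2 i ∈ S) (hb : ∀ p ∈ t, p.2.1.Realize (Sum.elim b p.2.2)) :
    ∃ a : Fin m → S, ∀ p ∈ t, p.2.1.Realize (Sum.elim (fun i => (a i : 𝕄)) p.2.2) := by
  let P := Σ p : t, Fin p.1.1
  let c : P → S := fun x => ⟨x.1.1.2.2 x.2, hS _ x.1.2 _⟩
  let g : ∀ p : t, Fin m ⊕ Fin p.1.1 → P ⊕ Fin m := fun p =>
    Sum.elim Sum.inr fun i => Sum.inl ⟨p, i⟩
  let χ : L.Formula P :=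
    Formula.iExs (Fin m) (Formula.iInf fun p : t => p.1.2.1.relabel (g p))
  have hχ : χ.Realize (S.subtype ∘ c) := by
    rw [Formula.realize_iExs]
    refine ⟨b, ?_⟩
    rw [Formula.realize_iInf]
    intro p
    rw [Formula.realize_relabel]
    convert hb p.1 p.2 using 1
    funext x
    rcases x with x | x <;> rfl
  rw [S.subtype.map_formula, Formula.realize_iExs] at hχ
  obtain ⟨a, ha⟩ := hχ
  refine ⟨a, fun p hp => ?_⟩
  rw [Formula.realize_iInf] at ha
  have := ha ⟨p, hp⟩
  rw [Formula.realize_relabel, ← S.subtype.map_formula] at this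
  convert this using 1
  funext x
  rcases x with x | x <;> rfl

/-- The ultrafilter induces a coheir of the type of `b` over the submodel. -/
def IsCoheirOf (V : Ultrafilter (Fin 1 → Fin m → S)) (b : Fin m → 𝕄) : Prop :=
  ∀ p : FmlP L 𝕄 (Fin m), (∀ i, p.2.2 i ∈ S) → p.2.1.Realize (Sum.elim b p.2.2) →
    EventuallyRealizes V p

theorem exists_isCoheirOf (b : Fin m → 𝕄) :
    ∃ V : Ultrafilter (Fin 1 → Fin m → S), IsCoheirOf V b := by
  obtain ⟨V, hV⟩ := exists_ultrafilter (S := S) {p : FmlP L 𝕄 (Fin m) | (∀ i, p.2.2 i ∈ S) ∧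
    p.2.1.Realize (Sum.elim b p.2.2)} fun t ht => exists_realization_in_submodel b t
      (fun p hp => (ht hp).1) fun p hp => (ht hp).2
  exact ⟨V, fun p h h' => hV p ⟨h, h'⟩⟩

theorem IsCoheirOf.sameType {V V' : Ultrafilter (Fin 1 → Fin m → S)} {b : Fin m → 𝕄}
    (h : IsCoheirOf V b) (h' : IsCoheirOf V' b) : (definableStr L S m).SameType V V' := by
  refine DefStr.sameType_of_imp fun D hD hDV => ?_
  obtain ⟨n, φ, c, hφ⟩ := exists_formula_of_isDef hD
  let f : (Fin 1 × Fin m) ⊕ Fin n → Fin m ⊕ Fin n := Sum.map Prod.snd id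
  have key : ∀ y : Fin 1 → Fin m → S, y ∈ D ↔ (φ.relabel f).Realize
      (Sum.elim (fun i => (y 0 i : 𝕄)) fun i => (c i : 𝕄)) := fun y => by
    rw [hφ, Formula.realize_relabel]
    refine iff_of_eq (congrArg _ ?_)
    funext x
    rcases x with ⟨i, k⟩ | x
    · rw [Fin.fin_one_eq_zero i]
      rfl
    · rfl
  by_cases hb : (φ.relabel f).Realize (Sum.elim b fun i => (c i : 𝕄))
  · exact (h' ⟨n, φ.relabel f, fun i => c i⟩ (fun i => (c i).2) hb).mono fun y hy => (key y).2 hy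
  · have := h ⟨n, (φ.relabel f).not, fun i => c i⟩ (fun i => (c i).2) (Formula.realize_not.2 hb)
    obtain ⟨y, hy, hy'⟩ := (this.and hDV).exists
    exact absurd ((key y).1 hy') (Formula.realize_not.1 hy)

theorem IsCoheirOf.of_sameType {V V' : Ultrafilter (Fin 1 → Fin m → S)} {b : Fin m → 𝕄}
    (h : IsCoheirOf V b) (h' : (definableStr L S m).SameType V' V) : IsCoheirOf V' b := by
  rintro ⟨n, φ, c⟩ hc hb
  have hD := isDef_realize (S := S) (φ.relabel (Sum.map (fun k => ((0 : Fin 1), k)) id))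
    fun i => ⟨c i, hc i⟩
  have key : ∀ y : Fin 1 → Fin m → S, (φ.relabel (Sum.map (fun k => ((0 : Fin 1), k)) id)).Realize
      (Sum.elim (fun p => (y p.1 p.2 : 𝕄)) c) ↔
        φ.Realize (Sum.elim (fun i => (y 0 i : 𝕄)) c) := fun y => by
    rw [Formula.realize_relabel]
    refine iff_of_eq (congrArg _ ?_)
    funext x
    rcases x with x | x <;> rfl
  have := (h' _ hD).2 ((h ⟨n, φ, c⟩ hc hb).mono fun y hy => (key y).2 hy)
  exact Eventually.mono (f := (V' : Filter (Fin 1 → Fin m → S))) this fun y hy => (key y).1 hy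

/-- The global coheir induced by an ultrafilter on the tuples of a submodel. -/
def globalType (U : Ultrafilter (Fin 1 → Fin m → S)) : GlobalType L 𝕄 (Fin m) where
  carrier := {p | EventuallyRealizes U p}
  consistent t ht := by
    obtain ⟨y, hy⟩ := ((eventually_all_finset t).2 fun p hp => ht hp).exists
    exact ⟨fun i => y 0 i, hy⟩
  complete n φ c := by
    rcases U.em (p := fun y => φ.Realize (Sum.elim (fun i => (y 0 i : 𝕄)) c)) with h | h
    · exact Or.inl h
    · exact Or.inr h

theorem finSatInM_globalType (U : Ultrafilter (Fin 1 → Fin m → S)) :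
    (globalType U).FinSatInM (S : Set 𝕄) := fun t ht => by
  obtain ⟨y, hy⟩ := ((eventually_all_finset t).2 fun p hp => ht hp).exists
  exact ⟨fun i => y 0 i, fun i => (y 0 i).2, hy⟩

theorem mem_carrier_of_realizesType {α : Type v} {q : GlobalType L 𝕄 α} {a : α → 𝕄} {C : Set 𝕄}
    (h : RealizesType q a C) {n : ℕ} {φ : L.Formula (α ⊕ Fin n)} {c : Fin n → 𝕄}
    (hc : ∀ i, c i ∈ C) (hφ : φ.Realize (Sum.elim a c)) :
    (⟨n, (φ, c)⟩ : FmlP L 𝕄 α) ∈ q.carrier :=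
  (q.complete n φ c).resolve_right fun hn =>
    absurd hφ (Formula.realize_not.1 (h n φ.not c hc hn))

/-- The type of a coheir Morley sequence is given by the powers of an ultrafilter. -/
theorem eventually_power_of_morleyIn {q : GlobalType L 𝕄 (Fin m)} {B : ℕ → Fin m → 𝕄}
    (hB : MorleyIn q S B) {V : Ultrafilter (Fin 1 → Fin m → S)}
    (hV : ∀ p ∈ q.carrier, EventuallyRealizes V p) (l : ℕ) {δ : Type} [Finite δ]
    (φ : L.Formula ((Fin l × Fin m) ⊕ δ)) (c : δ → S)
    (hφ : φ.Realize (Sum.elim (fun p => B p.1 p.2) fun i => (c i : 𝕄))) :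
    ∀ᶠ y in (power V l : Filter (Fin l → Fin m → S)),
      φ.Realize (Sum.elim (fun p => (y p.1 p.2 : 𝕄)) fun i => (c i : 𝕄)) := by
  induction l generalizing δ with
  | zero =>
    refine Eventually.of_forall fun y => ?_
    convert hφ using 1
    funext x
    rcases x with ⟨i, k⟩ | x
    · exact i.elim0
    · rfl
  | succ l ih =>
    obtain ⟨n, ⟨e⟩⟩ := Finite.exists_equiv_fin ((Fin l × Fin m) ⊕ δ)
    let f : (Fin (l + 1) × Fin m) ⊕ δ → Fin m ⊕ Fin n := Sum.elim (fun p =>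
      Fin.lastCases (motive := fun _ => Fin m ⊕ Fin n) (Sum.inl p.2)
        (fun i => Sum.inr (e (Sum.inl (i, p.2)))) p.1) fun d => Sum.inr (e (Sum.inr d))
    let d : Fin n → 𝕄 := fun j =>
      Sum.elim (fun p : Fin l × Fin m => B p.1 p.2) (fun i => (c i : 𝕄)) (e.symm j)
    have hd : ∀ j, d j ∈ (S : Set 𝕄) ∪ ⋃ (j : ℕ) (_ : j < l), Set.range (B j) := fun j => by
      simp only [d]
      rcases e.symm j with p | p
      · exact Or.inr (Set.mem_iUnion₂.2 ⟨p.1, p.1.2, p.2, rfl⟩)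
      · exact Or.inl (c p).2
    have hmem := mem_carrier_of_realizesType (hB.2 l) (φ := φ.relabel f) hd (by
      rw [Formula.realize_relabel]
      convert hφ using 1
      funext x
      rcases x with ⟨i, k⟩ | x
      · induction i using Fin.lastCases <;> simp [f, d]
      · simp [f, d])
    let g : (Fin (l + 1) × Fin m) ⊕ δ → (Fin l × Fin m) ⊕ (δ ⊕ Fin m) := Sum.elim (fun p =>
      Fin.lastCases (motive := fun _ => (Fin l × Fin m) ⊕ (δ ⊕ Fin m)) (Sum.inr (Sum.inr p.2))
        (fun i => Sum.inl (i, p.2)) p.1) fun d => Sum.inr (Sum.inl d)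
    change ∀ᶠ v in (V : Filter (Fin 1 → Fin m → S)),
      ∀ᶠ x in (power V l : Filter (Fin l → Fin m → S)), φ.Realize (Sum.elim
        (fun p : Fin (l + 1) × Fin m => ((Sum.elim x v ((Fin.snoc Sum.inl (Sum.inr 0) :
          Fin (l + 1) → Fin l ⊕ Fin 1) p.1) : Fin m → S) p.2 : 𝕄)) fun i => (c i : 𝕄))
    refine Eventually.mono (hV _ hmem) fun v hv => ?_
    have := ih (φ.relabel g) (Sum.elim c (v 0)) (by
      rw [Formula.realize_relabel]
      rw [Formula.realize_relabel] at hv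
      convert hv using 1
      funext x
      rcases x with ⟨i, k⟩ | x
      · induction i using Fin.lastCases <;> simp [f, d, g]
      · simp [f, d, g])
    refine Eventually.mono (f := (power V l : Filter (Fin l → Fin m → S))) this fun y hy => ?_
    rw [Formula.realize_relabel] at hy
    convert hy using 1
    funext x
    rcases x with ⟨i, k⟩ | x
    · induction i using Fin.lastCases <;> simp [g]
    · simp [g]

variable {κ : Cardinal.{u}}

/-- A compatible sequence of types of finite trees over the submodel is realized by an infinite
tree. -/
theorem exists_tree_realization (hκ : Cardinal.aleph0 < κ) (hsat : IsSaturated L 𝕄 κ)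
    (hS : Cardinal.mk (S : Set 𝕄) < κ) (W : ∀ N, Ultrafilter (TreeIdx N → Fin m → S)) :
    ∃ b : List Bool → Fin m → 𝕄, ∀ (n : ℕ) (φ : L.Formula ((List Bool × Fin m) ⊕ Fin n))
      (c : Fin n → S), (∀ᶠ N in atTop, ∀ᶠ y in (W N : Filter (TreeIdx N → Fin m → S)),
        φ.Realize (Sum.elim (fun p => (y (TreeIdx.node N p.1) p.2 : 𝕄)) fun i => (c i : 𝕄))) →
      φ.Realize (Sum.elim (fun p => b p.1 p.2) fun i => (c i : 𝕄)) := by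
  let Γ : Set (FmlP L 𝕄 (ULift.{u} (List Bool × Fin m))) := {p | (∀ i, p.2.2 i ∈ S) ∧
    ∀ᶠ N in atTop, ∀ᶠ y in (W N : Filter (TreeIdx N → Fin m → S)), p.2.1.Realize
      (Sum.elim (fun x => (y (TreeIdx.node N x.down.1) x.down.2 : 𝕄)) p.2.2)}
  obtain ⟨a, ha⟩ := hsat (ULift.{u} (List Bool × Fin m)) S
    ((Cardinal.mk_le_aleph0 (α := ULift.{u} (List Bool × Fin m))).trans_lt hκ) hS Γ
    (fun p hp => hp.1) fun t ht => by
      obtain ⟨N, hN⟩ := ((eventually_all_finset t).2 fun p hp => (ht hp).2).exists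
      obtain ⟨y, hy⟩ := ((eventually_all_finset t).2 hN).exists
      exact ⟨_, hy⟩
  refine ⟨fun η k => a ⟨(η, k)⟩, fun n φ c h => ?_⟩
  have key : ∀ f : List Bool × Fin m → 𝕄,
      (φ.relabel (Sum.map ULift.up id)).Realize (Sum.elim (fun x => f x.down) fun i => (c i : 𝕄)) ↔
        φ.Realize (Sum.elim f fun i => (c i : 𝕄)) := fun f => by
    rw [Formula.realize_relabel]
    refine iff_of_eq (congrArg _ ?_)
    funext x
    rcases x with x | x <;> rfl
  refine (key fun p => a ⟨p⟩).1 (ha ⟨n, φ.relabel (Sum.map ULift.up id), fun i => c i⟩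
    ⟨fun i => (c i).2, h.mono fun N hN => ?_⟩)
  exact hN.mono fun y hy => (key _).2 hy

/-- There is an infinite tree whose descending combs are coheir Morley sequences in `U`, and whose
paths, read downwards, are coheir Morley sequences in `V`. -/
theorem exists_comb_tree (hκ : Cardinal.aleph0 < κ) (hsat : IsSaturated L 𝕄 κ)
    (hS : Cardinal.mk (S : Set 𝕄) < κ) {U V : Ultrafilter (Fin 1 → Fin m → S)}
    (hVU : (definableStr L S m).SameType V U) (hU : ∀ n, (definableStr L S m).Good n U) :
    ∃ b : List Bool → Fin m → 𝕄, ∀ (n l : ℕ) (φ : L.Formula ((Fin l × Fin m) ⊕ Fin n))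
      (c : Fin n → S) (η : Fin l → List Bool),
      ((∀ i j, i < j → η j <+: η i ∧ η j ≠ η i) →
        (∀ᶠ y in (power V l : Filter (Fin l → Fin m → S)),
          φ.Realize (Sum.elim (fun p => (y p.1 p.2 : 𝕄)) fun i => (c i : 𝕄))) →
        φ.Realize (Sum.elim (fun p => b (η p.1) p.2) fun i => (c i : 𝕄))) ∧
      (DescendingComb η →
        (∀ᶠ y in (power U l : Filter (Fin l → Fin m → S)),
          φ.Realize (Sum.elim (fun p => (y p.1 p.2 : 𝕄)) fun i => (c i : 𝕄))) →
        φ.Realize (Sum.elim (fun p => b (η p.1) p.2) fun i => (c i : 𝕄))) := by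
  choose W _ hW using fun N => DefStr.exists_isCombTree hVU hU N 0
  obtain ⟨b, hb⟩ := exists_tree_realization hκ hsat hS W
  refine ⟨b, fun n l φ c η => ?_⟩
  obtain ⟨N₀, hN₀⟩ : ∃ N₀, ∀ i, (η i).length ≤ N₀ :=
    ⟨_, fun i => Finset.le_sup (f := fun i => (η i).length) (Finset.mem_univ i)⟩
  have key : ∀ Q : Ultrafilter (Fin l → Fin m → S),
      (∀ N, N₀ ≤ N → (definableStr L S m).SameType
        (restrict (fun i => TreeIdx.node N (η i)) (W N)) Q) →
      (∀ᶠ y in (Q : Filter (Fin l → Fin m → S)),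
        φ.Realize (Sum.elim (fun p => (y p.1 p.2 : 𝕄)) fun i => (c i : 𝕄))) →
      φ.Realize (Sum.elim (fun p => b (η p.1) p.2) fun i => (c i : 𝕄)) := fun Q hQ hφ => by
    have hrel : ∀ f : List Bool × Fin m → 𝕄,
        (φ.relabel (Sum.map (Prod.map η id) id)).Realize (Sum.elim f fun i => (c i : 𝕄)) ↔
          φ.Realize (Sum.elim (fun p => f (η p.1, p.2)) fun i => (c i : 𝕄)) := fun f => by
      rw [Formula.realize_relabel]
      refine iff_of_eq (congrArg _ ?_)
      funext x
      rcases x with x | x <;> rfl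
    refine (hrel fun p => b p.1 p.2).1 (hb n _ c ?_)
    filter_upwards [eventually_ge_atTop N₀] with N hN
    have := (hQ N hN _ (isDef_realize φ c)).2 hφ
    exact Eventually.mono (f := (W N : Filter (TreeIdx N → Fin m → S))) this
      fun y hy => (hrel _).2 hy
  exact ⟨fun h => key _ fun N hN => (hW N).path l η (fun i => (hN₀ i).trans hN) h,
    fun h => key _ fun N hN => (hW N).comb l η (fun i => (hN₀ i).trans hN) h⟩

theorem ofFn_prefix_ofFn {A : Type v} (σ : ℕ → A) {i j : ℕ} (h : i ≤ j) :
    (List.ofFn fun k : Fin i => σ k) <+: List.ofFn fun k : Fin j => σ k := by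
  obtain ⟨d, rfl⟩ := Nat.exists_eq_add_of_le h
  rw [List.ofFn_add]
  exact List.prefix_append _ _

/-- The formula expressing that `l` instances of `ψ` are jointly consistent. -/
noncomputable def jointConsistency {r s m : ℕ} (ψ : L.Formula (Fin r ⊕ (Fin s ⊕ Fin m))) (l : ℕ) :
    L.Formula ((Fin l × Fin m) ⊕ Fin s) :=
  Formula.iExs (Fin r) (Formula.iInf fun i : Fin l => ψ.relabel (Sum.elim Sum.inr
    (Sum.elim (fun j => Sum.inl (Sum.inr j)) fun k => Sum.inl (Sum.inl (i, k)))))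

theorem realize_jointConsistency {r s m l : ℕ} {ψ : L.Formula (Fin r ⊕ (Fin s ⊕ Fin m))}
    {y : Fin l × Fin m → 𝕄} {e : Fin s → 𝕄} :
    (jointConsistency ψ l).Realize (Sum.elim y e) ↔
      ∃ a : Fin r → 𝕄, ∀ i, ψ.Realize (Sum.elim a (Sum.elim e fun k => y (i, k))) := by
  rw [jointConsistency, Formula.realize_iExs]
  refine exists_congr fun a => ?_
  rw [Formula.realize_iInf]
  refine forall_congr' fun i => ?_
  rw [Formula.realize_relabel]
  refine iff_of_eq (congrArg _ ?_)
  funext x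
  rcases x with x | x | x <;> rfl

theorem exists_finite_inconsistent (hκ : Cardinal.aleph0 < κ) (hsat : IsSaturated L 𝕄 κ)
    {r n : ℕ} (ψ : L.Formula (Fin r ⊕ Fin n)) (B : ℕ → Fin n → 𝕄)
    (h : ¬ ∃ a : Fin r → 𝕄, ∀ i, ψ.Realize (Sum.elim a (B i))) :
    ∃ l : ℕ, ¬ ∃ a : Fin r → 𝕄, ∀ i < l, ψ.Realize (Sum.elim a (B i)) := by
  by_contra! hcon
  have key : ∀ (a : Fin r → 𝕄) (i : ℕ),
      (ψ.relabel (Sum.map ULift.up.{u} id)).Realize (Sum.elim (fun x => a x.down) (B i)) ↔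
        ψ.Realize (Sum.elim a (B i)) := fun a i => by
    rw [Formula.realize_relabel]
    refine iff_of_eq (congrArg _ ?_)
    funext x
    rcases x with x | x <;> rfl
  obtain ⟨a, ha⟩ := hsat (ULift.{u} (Fin r)) (⋃ i, Set.range (B i))
    ((Cardinal.mk_le_aleph0 (α := ULift.{u} (Fin r))).trans_lt hκ)
    ((Cardinal.le_aleph0_iff_set_countable.2
      (Set.countable_iUnion fun i => Set.countable_range (B i))).trans_lt hκ)
    (Set.range fun i => ⟨n, (ψ.relabel (Sum.map ULift.up id), B i)⟩)
    (by
      rintro _ ⟨i, rfl⟩ k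
      exact Set.mem_iUnion.2 ⟨i, k, rfl⟩)
    fun t ht => by
      classical
      obtain ⟨t, -, rfl⟩ := Finset.subset_set_image_iff.1 (Set.image_univ ▸ ht)
      obtain ⟨a, ha⟩ := hcon (t.sup id + 1)
      refine ⟨fun x => a x.down, fun p hp => ?_⟩
      obtain ⟨i, hi, rfl⟩ := Finset.mem_image.1 hp
      exact (key a i).2 (ha i (Nat.lt_succ_of_le (Finset.le_sup (f := id) hi)))
  exact h ⟨fun j => a ⟨j⟩, fun i => (key _ i).1 (ha _ ⟨i, rfl⟩)⟩

end ModelTheory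

/-- **Theorem 4.10.** Let `T` be a complete theory without `k`-`DCTP₂` for all
`k ≥ 2`.  Then for any small elementary submodel `M` of `𝕄` and any tuple
`b`, there is a global type extending `tp(b/M)`, finitely satisfiable in `M`,
such that for any formula `φ(x,y)` over `M`: if coheir Morley sequences in
this type do not witness Kim-dividing of `φ(x,b)` over `M`, then no coheir
Morley sequence over `M` starting with `b` witnesses Kim-dividing of `φ(x,b)`
over `M`. -/
theorem natp_kims_lemma (L : FirstOrder.Language.{u, u}) (𝕄 : Type u) [L.Structure 𝕄]
    (κ : Cardinal.{u}) (hmonster : IsMonster L 𝕄 κ)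
    (hnodctp2 : ∀ k : ℕ, 2 ≤ k → ¬ HasKDCTP2 L 𝕄 k)
    (Ms : Set 𝕄) (hMs : IsElemSubmodel L Ms) (hMssmall : Cardinal.mk Ms < κ)
    (m : ℕ) (b : Fin m → 𝕄) :
    ∃ q : GlobalType L 𝕄 (Fin m), q.FinSatInM Ms ∧ ExtendsTpOver q Ms b ∧
      ∀ (r s : ℕ) (ψ : L.Formula (Fin r ⊕ (Fin s ⊕ Fin m))) (e : Fin s → 𝕄),
        (∀ i, e i ∈ Ms) →
        (∃ B : ℕ → Fin m → 𝕄, MorleyIn q Ms B ∧ B 0 = b ∧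
          ∃ a : Fin r → 𝕄, ∀ i, ψ.Realize (Sum.elim a (Sum.elim e (B i)))) →
        ∀ B' : ℕ → Fin m → 𝕄, CoheirMorley L Ms B' → B' 0 = b →
          ∃ a : Fin r → 𝕄, ∀ i, ψ.Realize (Sum.elim a (Sum.elim e (B' i))) := by
  obtain ⟨hκ, hsat, -⟩ := hmonster
  obtain ⟨S, rfl⟩ := hMs
  obtain ⟨U₀, hU₀⟩ := exists_isCoheirOf (S := S) b
  obtain ⟨U, hUU₀, hU⟩ := DefStr.exists_good (𝔇 := definableStr L S m) U₀
  have hUb : IsCoheirOf U b := hU₀.of_sameType hUU₀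
  refine ⟨globalType U, finSatInM_globalType U, fun n φ c hc hφ => hUb ⟨n, φ, c⟩ hc hφ, ?_⟩
  rintro r s ψ e he ⟨B, hB, -, a, ha⟩ B' ⟨q', hB'⟩ rfl
  by_contra hcon
  obtain ⟨V, hV⟩ := exists_ultrafilter (S := S) q'.carrier fun t ht => by
    obtain ⟨a, haS, ha⟩ := hB'.1 t ht
    exact ⟨fun i => ⟨a i, haS i⟩, ha⟩
  have hVb : IsCoheirOf V (B' 0) := fun ⟨n, φ, c⟩ hc hφ =>
    hV _ (mem_carrier_of_realizesType (hB'.2 0) (fun i => Or.inl (hc i)) hφ)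
  obtain ⟨d, hd⟩ := exists_comb_tree hκ hsat hMssmall (hVb.sameType hUb) hU
  let e' : Fin s → S := fun i => ⟨e i, he i⟩
  let ψ' : L.Formula (Fin r ⊕ Fin (s + m)) := ψ.relabel (Sum.map id finSumFinEquiv)
  have hψ' : ∀ (a : Fin r → 𝕄) (x : Fin m → 𝕄),
      ψ'.Realize (Sum.elim a (Fin.append e x)) ↔ ψ.Realize (Sum.elim a (Sum.elim e x)) :=
    fun a x => by
      rw [Formula.realize_relabel]
      refine iff_of_eq (congrArg _ ?_)
      funext y
      rcases y with y | y | y <;> simp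
  obtain ⟨l, hl⟩ := exists_finite_inconsistent hκ hsat ψ' (fun i => Fin.append e (B' i))
    (by simpa only [hψ'] using hcon)
  have hpath : ∀ᶠ y in (power V (max l 2) : Filter (Fin (max l 2) → Fin m → S)),
      (jointConsistency ψ (max l 2)).not.Realize
        (Sum.elim (fun p => (y p.1 p.2 : 𝕄)) fun i => (e' i : 𝕄)) := by
    refine eventually_power_of_morleyIn hB' hV _ _ _ ?_
    rw [Formula.realize_not, realize_jointConsistency]
    rintro ⟨a, ha⟩
    exact hl ⟨a, fun i hi => (hψ' _ _).2 (ha ⟨i, lt_max_of_lt_left hi⟩)⟩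
  refine hnodctp2 (max l 2) (le_max_right _ _)
    ⟨r, s + m, ψ', fun η => Fin.append e (d η), fun σ t ht => ?_, fun j η hη => ?_⟩
  · rintro ⟨a, ha⟩
    have := (hd s _ _ e' fun i => List.ofFn fun k : Fin (t.orderEmbOfFin ht i.rev) => σ k).1
      (fun i j hij => by
        have hlt := (t.orderEmbOfFin ht).strictMono (Fin.rev_lt_rev.2 hij)
        refine ⟨ofFn_prefix_ofFn σ hlt.le, fun h => hlt.ne ?_⟩
        simpa using congrArg List.length h) hpath
    rw [Formula.realize_not, realize_jointConsistency] at this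
    exact this ⟨a, fun i => (hψ' a (d _)).1 (ha _ (t.orderEmbOfFin_mem ht i.rev))⟩
  · have hcomb := (hd s _ (jointConsistency ψ j) e' η).2 hη <|
      eventually_power_of_morleyIn hB (fun p hp => hp) j _ _ (by
        rw [realize_jointConsistency]
        exact ⟨a, fun i => ha i⟩)
    rw [realize_jointConsistency] at hcomb
    obtain ⟨a, ha⟩ := hcomb
    exact ⟨a, fun i => (hψ' _ _).2 (ha i)⟩

end NSOP2Paper
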